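/- arXiv:2401.00783 — 4 statements merged into one kernel-verified Lean document; each statement's English description precedes it below -/
import Mathlib

section
/- Let k be a field, δ ≥ 2, and 1 ≤ l ≤ δ−1. The kernel of the surjective R-linear map R^(l+1) → M^(l) sending the standard basis element e_m to x^(l+1−m) y^(m−1) for 1 ≤ m ≤ l+1 is generated as an R-module by the δ·l elements x^(δ−k) y^k e_m − x^(δ−k+1) y^(k−1) e_(m+1), where 1 ≤ k ≤ δ and 1 ≤ m ≤ l. -/
open MvPolynomial CategoryTheory Filter

set_option synthInstance.maxHeartbeats 1000000
set_option maxHeartbeats 2000000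

noncomputable section

variable (k : Type) [Field k]

/-- The δ-th Veronese subalgebra `R = k[x^δ, x^(δ-1)y, …, y^δ]` of `S = k[x,y]`. -/
def Rver (δ : ℕ) : Subalgebra k (MvPolynomial (Fin 2) k) :=
  Algebra.adjoin k { g : MvPolynomial (Fin 2) k | ∃ i ≤ δ, g = X 0 ^ (δ - i) * X 1 ^ i }

/-- The maximal Cohen-Macaulay module `M^(l) = ⊕_{n≥0} S_{nδ+l}`: the `R`-submodule of `S`
generated by `x^l, x^(l-1)y, …, y^l`. -/
def Mmod (δ l : ℕ) : Submodule ↥(Rver k δ) (MvPolynomial (Fin 2) k) :=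
  Submodule.span ↥(Rver k δ) { g | ∃ m ≤ l, g = X 0 ^ (l - m) * X 1 ^ m }

/-- The monomial `x^(δ-i) y^i` as an element of `R`. -/
def genR (δ i : ℕ) (h : i ≤ δ) : ↥(Rver k δ) :=
  ⟨X 0 ^ (δ - i) * X 1 ^ i, Algebra.subset_adjoin ⟨i, h, rfl⟩⟩

/-- The `R`-linear map `R^(l+1) → M^(l) ⊆ S` sending the basis element `e_m`
(for `1 ≤ m ≤ l+1`, here `0`-indexed) to `x^(l+1-m) y^(m-1)`. -/
def pMap (δ l : ℕ) : (Fin (l + 1) → ↥(Rver k δ)) →ₗ[↥(Rver k δ)] MvPolynomial (Fin 2) k :=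
  ∑ m : Fin (l + 1),
    (LinearMap.toSpanSingleton ↥(Rver k δ) (MvPolynomial (Fin 2) k)
      (X 0 ^ (l - (m : ℕ)) * X 1 ^ (m : ℕ))).comp (LinearMap.proj m)

theorem X_pow_mul_X_pow_mem_Rver {δ : ℕ} (hδ : 0 < δ) (c d : ℕ) (h : δ ∣ c + d) :
    (X 0 ^ c * X 1 ^ d : MvPolynomial (Fin 2) k) ∈ Rver k δ := by
  induction hn : c + d using Nat.strong_induction_on generalizing c d with
  | _ n ih =>
    subst hn
    rcases Nat.eq_zero_or_pos (c + d) with h0 | h0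
    · obtain ⟨rfl, rfl⟩ : c = 0 ∧ d = 0 := by omega
      simp
    · have hle := Nat.le_of_dvd h0 h
      have hi : min d δ ≤ δ := min_le_right _ _
      have hdvd : δ ∣ (c - (δ - min d δ)) + (d - min d δ) := by
        have : (c - (δ - min d δ)) + (d - min d δ) = c + d - δ := by omega
        rw [this]
        exact Nat.dvd_sub h dvd_rfl
      have hmem := (Rver k δ).mul_mem (genR k δ (min d δ) hi).2
        (ih _ (by omega) (c - (δ - min d δ)) (d - min d δ) hdvd rfl)
      have hmul : (X 0 ^ c * X 1 ^ d : MvPolynomial (Fin 2) k) =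
          (X 0 ^ (δ - min d δ) * X 1 ^ min d δ) *
            (X 0 ^ (c - (δ - min d δ)) * X 1 ^ (d - min d δ)) := by
        rw [mul_mul_mul_comm, ← pow_add, ← pow_add]
        congr 2 <;> omega
      rw [hmul]
      exact hmem

/-- The monomial `x^c y^d`, of degree divisible by `δ`, as an element of `R`. -/
def monR {δ : ℕ} (hδ : 0 < δ) (c d : ℕ) (h : δ ∣ c + d) : ↥(Rver k δ) :=
  ⟨X 0 ^ c * X 1 ^ d, X_pow_mul_X_pow_mem_Rver k hδ c d h⟩

theorem mem_span_of_mem_Rver {δ : ℕ} {r : MvPolynomial (Fin 2) k} (hr : r ∈ Rver k δ) :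
    r ∈ Submodule.span k
      { g : MvPolynomial (Fin 2) k | ∃ c d : ℕ, δ ∣ c + d ∧ g = X 0 ^ c * X 1 ^ d } := by
  rw [Rver, ← Subalgebra.mem_toSubmodule, Algebra.adjoin_eq_span] at hr
  refine Submodule.span_mono ?_ hr
  intro g hg
  induction hg using Submonoid.closure_induction with
  | mem g hg =>
    obtain ⟨i, hi, rfl⟩ := hg
    exact ⟨δ - i, i, by rw [Nat.sub_add_cancel hi], rfl⟩
  | one => exact ⟨0, 0, by simp, by simp⟩
  | mul g g' _ _ hg hg' =>
    obtain ⟨c, d, h, rfl⟩ := hg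
    obtain ⟨c', d', h', rfl⟩ := hg'
    refine ⟨c + c', d + d', ?_, by ring⟩
    rw [add_add_add_comm]
    exact dvd_add h h'

/-- The span of the linear relations `x^(δ-i-1) y^(i+1) e_m - x^(δ-i) y^i e_(m+1)`. -/
def relSpan (δ l : ℕ) : Submodule ↥(Rver k δ) (Fin (l + 1) → ↥(Rver k δ)) :=
  Submodule.span ↥(Rver k δ)
    { v : Fin (l + 1) → ↥(Rver k δ) |
      ∃ (i m : ℕ) (hi : i < δ) (hm : m < l),
        v = genR k δ (i + 1) hi •
              (Pi.single ⟨m, hm.trans l.lt_succ_self⟩ 1 : Fin (l + 1) → ↥(Rver k δ))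
          - genR k δ i hi.le •
              (Pi.single ⟨m + 1, Nat.succ_lt_succ hm⟩ 1 : Fin (l + 1) → ↥(Rver k δ)) }

theorem mkQ_single_monR_succ {δ l : ℕ} (hδ : 0 < δ) (c d m : ℕ) (h : δ ∣ c + (d + 1))
    (h' : δ ∣ (c + 1) + d) (hm : m < l) :
    (relSpan k δ l).mkQ (Pi.single ⟨m, by omega⟩ (monR k hδ c (d + 1) h)) =
      (relSpan k δ l).mkQ (Pi.single ⟨m + 1, by omega⟩ (monR k hδ (c + 1) d h')) := by
  have hle := Nat.le_of_dvd (by omega) h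
  obtain ⟨i, hi⟩ : ∃ i, i + 1 = min (d + 1) δ := ⟨min (d + 1) δ - 1, by omega⟩
  have hdvd : δ ∣ (c - (δ - (i + 1))) + (d + 1 - (i + 1)) := by
    have : (c - (δ - (i + 1))) + (d + 1 - (i + 1)) = c + (d + 1) - δ := by omega
    rw [this]
    exact Nat.dvd_sub h dvd_rfl
  rw [← sub_eq_zero, ← map_sub, Submodule.mkQ_apply, Submodule.Quotient.mk_eq_zero]
  have h1 : monR k hδ c (d + 1) h =
      monR k hδ (c - (δ - (i + 1))) (d + 1 - (i + 1)) hdvd * genR k δ (i + 1) (by omega) := by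
    apply Subtype.ext
    change (X 0 ^ c * X 1 ^ (d + 1) : MvPolynomial (Fin 2) k) =
      (X 0 ^ (c - (δ - (i + 1))) * X 1 ^ (d + 1 - (i + 1))) * (X 0 ^ (δ - (i + 1)) * X 1 ^ (i + 1))
    rw [mul_mul_mul_comm, ← pow_add, ← pow_add]
    congr 2 <;> omega
  have h2 : monR k hδ (c + 1) d h' =
      monR k hδ (c - (δ - (i + 1))) (d + 1 - (i + 1)) hdvd * genR k δ i (by omega) := by
    apply Subtype.ext
    change (X 0 ^ (c + 1) * X 1 ^ d : MvPolynomial (Fin 2) k) =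
      (X 0 ^ (c - (δ - (i + 1))) * X 1 ^ (d + 1 - (i + 1))) * (X 0 ^ (δ - i) * X 1 ^ i)
    rw [mul_mul_mul_comm, ← pow_add, ← pow_add]
    congr 2 <;> omega
  have hgen : genR k δ (i + 1) (by omega) •
        (Pi.single ⟨m, by omega⟩ 1 : Fin (l + 1) → ↥(Rver k δ))
      - genR k δ i (by omega) •
        (Pi.single ⟨m + 1, by omega⟩ 1 : Fin (l + 1) → ↥(Rver k δ)) ∈ relSpan k δ l :=
    Submodule.subset_span ⟨i, m, by omega, hm, rfl⟩
  have := (relSpan k δ l).smul_mem (monR k hδ (c - (δ - (i + 1))) (d + 1 - (i + 1)) hdvd) hgen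
  rw [smul_sub, smul_smul, smul_smul, ← h1, ← h2, ← Pi.single_smul, ← Pi.single_smul,
    smul_eq_mul, smul_eq_mul, mul_one, mul_one] at this
  exact this

theorem mkQ_single_monR_add {δ l : ℕ} (hδ : 0 < δ) (j : ℕ) : ∀ (c d m : ℕ) (h : δ ∣ c + (d + j))
    (h' : δ ∣ (c + j) + d) (hm : m + j < l + 1),
    (relSpan k δ l).mkQ (Pi.single ⟨m, by omega⟩ (monR k hδ c (d + j) h)) =
      (relSpan k δ l).mkQ (Pi.single ⟨m + j, hm⟩ (monR k hδ (c + j) d h')) := by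
  induction j with
  | zero => intros; rfl
  | succ j ih =>
    intro c d m h h' hm
    have h'' : δ ∣ (c + j) + (d + 1) := by convert h' using 1; omega
    have e := ih c (d + 1) m (by convert h using 1; omega) h'' (by omega)
    have e' := mkQ_single_monR_succ (l := l) k hδ (c + j) d (m + j) h'' h' (by omega)
    refine Eq.trans ?_ (e.trans e')
    simp only [add_assoc, add_comm 1 j]

/-- On monomials `x^a y^b` of degree congruent to `l` modulo `δ`, a section of `pMap` modulo the
linear relations, which uses the basis vector of the largest possible index. -/
def pSection {δ : ℕ} (hδ : 0 < δ) (l : ℕ) :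
    MvPolynomial (Fin 2) k →ₗ[k] (Fin (l + 1) → ↥(Rver k δ)) ⧸ relSpan k δ l :=
  (basisMonomials (Fin 2) k).constr k fun u =>
    if h : δ ∣ (u 0 - (l - min (u 1) l)) + (u 1 - min (u 1) l) then
      (relSpan k δ l).mkQ (Pi.single ⟨min (u 1) l, by omega⟩ (monR k hδ _ _ h))
    else 0

theorem pSection_X_pow_mul_X_pow {δ : ℕ} (hδ : 0 < δ) (l a b : ℕ) :
    pSection k hδ l (X 0 ^ a * X 1 ^ b) =
      if h : δ ∣ (a - (l - min b l)) + (b - min b l) then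
        (relSpan k δ l).mkQ (Pi.single ⟨min b l, by omega⟩ (monR k hδ _ _ h))
      else 0 := by
  have hX : (X 0 ^ a * X 1 ^ b : MvPolynomial (Fin 2) k) =
      basisMonomials (Fin 2) k (Finsupp.single 0 a + Finsupp.single 1 b) := by
    rw [coe_basisMonomials, X_pow_eq_monomial, X_pow_eq_monomial, monomial_mul, one_mul]
  rw [hX, pSection, Module.Basis.constr_basis]
  have h0 : (Finsupp.single 0 a + Finsupp.single 1 b : Fin 2 →₀ ℕ) 0 = a := by simp
  have h1 : (Finsupp.single 0 a + Finsupp.single 1 b : Fin 2 →₀ ℕ) 1 = b := by simp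
  simp only [h0, h1]

theorem pSection_mul {δ : ℕ} (hδ : 0 < δ) {l : ℕ} (m : Fin (l + 1)) (r : ↥(Rver k δ)) :
    pSection k hδ l ((r : MvPolynomial (Fin 2) k) * (X 0 ^ (l - (m : ℕ)) * X 1 ^ (m : ℕ))) =
      (relSpan k δ l).mkQ (Pi.single m r) := by
  obtain ⟨r, hr⟩ := r
  suffices ∃ hr : r ∈ Rver k δ, pSection k hδ l ((r : MvPolynomial (Fin 2) k) * (X 0 ^ (l - (m : ℕ)) * X 1 ^ (m : ℕ))) =
      (relSpan k δ l).mkQ (Pi.single m ⟨r, hr⟩) from this.2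
  replace hr := mem_span_of_mem_Rver k hr
  induction hr using Submodule.span_induction with
  | mem r h =>
    obtain ⟨c, d, h, rfl⟩ := h
    refine ⟨X_pow_mul_X_pow_mem_Rver k hδ c d h, ?_⟩
    obtain ⟨m, hm⟩ := m
    obtain ⟨j, hj⟩ : ∃ j, j = min d (l - m) := ⟨_, rfl⟩
    obtain ⟨d, rfl⟩ : ∃ d', d = d' + j := ⟨d - j, by omega⟩
    have h' : δ ∣ (c + j) + d := by convert h using 1; omega
    rw [mul_mul_mul_comm, ← pow_add, ← pow_add, pSection_X_pow_mul_X_pow]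
    have e0 : min (d + j + m) l = m + j := by omega
    have e1 : c + (l - m) - (l - (m + j)) = c + j := by omega
    have e2 : d + j + m - (m + j) = d := by omega
    simp only [e0, e1, e2]
    rw [dif_pos h', ← mkQ_single_monR_add k hδ j c d m h h' (by omega)]
    rfl
  | zero =>
    refine ⟨zero_mem _, ?_⟩
    rw [zero_mul, map_zero]
    exact ((congrArg _ (Pi.single_zero m)).trans (map_zero _)).symm
  | add r s _ _ h h' =>
    obtain ⟨hr, h⟩ := h
    obtain ⟨hs, h'⟩ := h'
    refine ⟨add_mem hr hs, ?_⟩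
    rw [add_mul, map_add, h, h', ← map_add, ← Pi.single_add]
    rfl
  | smul a r _ h =>
    obtain ⟨hr, h⟩ := h
    refine ⟨Subalgebra.smul_mem _ hr a, ?_⟩
    rw [smul_mul_assoc, map_smul, h, Submodule.mkQ_apply, ← Submodule.Quotient.mk_smul,
      ← Pi.single_smul]
    rfl

theorem pMap_apply (δ l : ℕ) (v : Fin (l + 1) → ↥(Rver k δ)) :
    pMap k δ l v =
      ∑ m : Fin (l + 1), (v m : MvPolynomial (Fin 2) k) *
        (X 0 ^ (l - (m : ℕ)) * X 1 ^ (m : ℕ)) := by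
  simp [pMap, LinearMap.sum_apply, Subalgebra.smul_def]

theorem pMap_single (δ l : ℕ) (m : Fin (l + 1)) (r : ↥(Rver k δ)) :
    pMap k δ l (Pi.single m r) = (r : MvPolynomial (Fin 2) k) * (X 0 ^ (l - (m : ℕ)) * X 1 ^ (m : ℕ)) := by
  rw [pMap_apply, Finset.sum_eq_single m]
  · rw [Pi.single_eq_same]
  · intro i _ hi
    rw [Pi.single_eq_of_ne hi, ZeroMemClass.coe_zero, zero_mul]
  · simp

theorem pSection_pMap {δ : ℕ} (hδ : 0 < δ) {l : ℕ} (v : Fin (l + 1) → ↥(Rver k δ)) :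
    pSection k hδ l (pMap k δ l v) = (relSpan k δ l).mkQ v := by
  rw [pMap_apply, map_sum, ← Finset.univ_sum_single v, map_sum]
  simp only [pSection_mul, Finset.univ_sum_single]

theorem ker_pMap_eq_span (k : Type) [Field k] (δ l : ℕ) (hδ : 2 ≤ δ) (hl1 : 1 ≤ l)
    (hl2 : l ≤ δ - 1) :
    LinearMap.ker (pMap k δ l) =
      Submodule.span ↥(Rver k δ)
        { v : Fin (l + 1) → ↥(Rver k δ) |
          ∃ kk : ℕ, ∃ hkk : 1 ≤ kk ∧ kk ≤ δ, ∃ m : ℕ, ∃ hm : 1 ≤ m ∧ m ≤ l,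
            v = genR k δ kk hkk.2 •
                  (Pi.single ⟨m - 1, by omega⟩ 1 : Fin (l + 1) → ↥(Rver k δ))
              - genR k δ (kk - 1) (by omega) •
                  (Pi.single ⟨m, by omega⟩ 1 : Fin (l + 1) → ↥(Rver k δ)) } := by
  apply le_antisymm
  · intro v hv
    have h := pSection_pMap k (by omega : 0 < δ) v
    rw [LinearMap.mem_ker.1 hv, map_zero] at h
    refine Submodule.span_mono ?_ ((Submodule.Quotient.mk_eq_zero (relSpan k δ l)).1 h.symm)
    rintro w ⟨i, m, hi, hm, rfl⟩
    exact ⟨i + 1, ⟨by omega, hi⟩, m + 1, ⟨by omega, hm⟩, rfl⟩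
  · rw [Submodule.span_le]
    rintro v ⟨i, hi, m, hm, rfl⟩
    rw [SetLike.mem_coe, LinearMap.mem_ker, map_sub, map_smul, map_smul, pMap_single,
      pMap_single, sub_eq_zero, Subalgebra.smul_def, Subalgebra.smul_def]
    simp only [genR, smul_eq_mul, OneMemClass.coe_one, one_mul]
    rw [mul_mul_mul_comm, ← pow_add, ← pow_add, mul_mul_mul_comm, ← pow_add, ← pow_add]
    congr 2 <;> omega
end
end

section
/- Let k be an algebraically closed field of prime characteristic p and δ ≥ 2. For every i ≥ 1, the i-th Frobenius Betti number of R equals δ(δ−1)^i / 2; that is, the sequence e ↦ dim_k Tor_i^R(^eR, R/𝔪) / p^(2e) converges to δ(δ−1)^i / 2 as e → ∞. -/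
open MvPolynomial CategoryTheory Filter

set_option synthInstance.maxHeartbeats 1000000
set_option maxHeartbeats 2000000

noncomputable section

variable (k : Type) [Field k]

/-- The graded maximal ideal `𝔪 = ⊕_{n≥1} S_{nδ}` of `R`: the elements of `R` with zero
constant term. -/
def mIdeal (δ : ℕ) : Ideal ↥(Rver k δ) :=
  RingHom.ker ((constantCoeff : MvPolynomial (Fin 2) k →+* k).comp (Rver k δ).val.toRingHom)

/-- The `i`-th Betti number `β_i(M) = dim_k Tor_i^R(M, R/𝔪)` of an `R`-module `M`. -/
def betti (δ : ℕ) (i : ℕ) (M : Type) [AddCommGroup M] [Module ↥(Rver k δ) M] : ℕ :=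
  Module.finrank k (RestrictScalars k ↥(Rver k δ)
    ((((Tor (ModuleCat ↥(Rver k δ)) i).obj (ModuleCat.of ↥(Rver k δ) M)).obj
      (ModuleCat.of ↥(Rver k δ) (↥(Rver k δ) ⧸ mIdeal k δ)))))

/-- The `e`-th iterated Frobenius endomorphism `r ↦ r^(p^e)` of `R`. -/
def frobR (δ : ℕ) (p : ℕ) [Fact p.Prime] [CharP k p] (e : ℕ) :
    ↥(Rver k δ) →+* ↥(Rver k δ) :=
  letI : CharP ↥(Rver k δ) p :=
    CharP.subsemiring (MvPolynomial (Fin 2) k) p (Rver k δ).toSubsemiring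
  iterateFrobenius ↥(Rver k δ) p e

/-- `^eR` : `R` viewed as an `R`-module by restriction of scalars along the `e`-th iterate
of the Frobenius endomorphism. -/
def eR (δ : ℕ) (p : ℕ) [Fact p.Prime] [CharP k p] (e : ℕ) : ModuleCat ↥(Rver k δ) :=
  (ModuleCat.restrictScalars (frobR k δ p e)).obj (ModuleCat.of ↥(Rver k δ) ↥(Rver k δ))

section TorShift

open MonoidalCategory

variable {R : Type} [CommRing R]

/-- The functor sending `X` to the complex `X ⊗ P`, evaluated on a short complex of modules. -/
abbrev tensorShortComplex (S : ShortComplex (ModuleCat R)) (P : ChainComplex (ModuleCat R) ℕ) :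
    ShortComplex (ChainComplex (ModuleCat R) ℕ) where
  X₁ := (((tensoringLeft (ModuleCat R)).obj S.X₁).mapHomologicalComplex _).obj P
  X₂ := (((tensoringLeft (ModuleCat R)).obj S.X₂).mapHomologicalComplex _).obj P
  X₃ := (((tensoringLeft (ModuleCat R)).obj S.X₃).mapHomologicalComplex _).obj P
  f := (NatTrans.mapHomologicalComplex ((tensoringLeft (ModuleCat R)).map S.f) _).app P
  g := (NatTrans.mapHomologicalComplex ((tensoringLeft (ModuleCat R)).map S.g) _).app P
  zero := by
    ext n : 1
    change S.f ▷ P.X n ≫ S.g ▷ P.X n = 0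
    rw [← comp_whiskerRight, S.zero]
    exact MonoidalPreadditive.zero_whiskerRight

theorem tensorShortComplex_shortExact {S : ShortComplex (ModuleCat R)} (hS : S.ShortExact)
    {K : ModuleCat R} (P : ProjectiveResolution K) :
    (tensorShortComplex S P.complex).ShortExact := by
  refine HomologicalComplex.shortExact_of_degreewise_shortExact _ fun n => ?_
  have : Module.Projective R (P.complex.X n) :=
    (IsProjective.iff_projective (P.complex.X n)).2 (P.projective n)
  refine ModuleCat.shortComplex_shortExact _ ?_ ?_ ?_
  · exact Module.Flat.rTensor_exact (P.complex.X n)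
      ((ShortComplex.ShortExact.moduleCat_exact_iff_function_exact S).1 hS.exact)
  · exact Module.Flat.rTensor_preserves_injective_linearMap S.f.hom hS.moduleCat_injective_f
  · exact LinearMap.rTensor_surjective (P.complex.X n) hS.moduleCat_surjective_g

theorem isZero_homology_tensor_of_flat (B : ModuleCat R) [Module.Flat R B]
    {K : ModuleCat R} (P : ProjectiveResolution K) (n : ℕ) :
    Limits.IsZero (((((tensoringLeft (ModuleCat R)).obj B).mapHomologicalComplex _).obj
      P.complex).homology (n + 1)) := by
  rw [← HomologicalComplex.exactAt_iff_isZero_homology,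
    HomologicalComplex.exactAt_iff' _ (n + 2) (n + 1) n (by simp) (by simp)]
  refine ModuleCat.shortComplex_exact _ ?_
  exact Module.Flat.lTensor_exact B
    ((ShortComplex.ShortExact.moduleCat_exact_iff_function_exact _).1 (P.exact_succ n))

/-- Dimension shifting for `Tor` in the first variable. -/
theorem nonempty_Tor_succ_succ_iso {S : ShortComplex (ModuleCat R)} (hS : S.ShortExact)
    [Module.Flat R S.X₂] (K : ModuleCat R) (n : ℕ) :
    Nonempty (((Tor (ModuleCat R) (n + 2)).obj S.X₃).obj K ≅
      ((Tor (ModuleCat R) (n + 1)).obj S.X₁).obj K) := by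
  let P := projectiveResolution K
  have h := tensorShortComplex_shortExact hS P
  exact ⟨P.isoLeftDerivedObj _ _ ≪≫
    h.δIso (n + 2) (n + 1) rfl (isZero_homology_tensor_of_flat S.X₂ P (n + 1))
      (isZero_homology_tensor_of_flat S.X₂ P n) ≪≫ (P.isoLeftDerivedObj _ _).symm⟩

/-- The comparison of `H₀(X ⊗ P)` with `X ⊗ K`, for a projective resolution `P` of `K`. -/
def homologyZeroTensorIso (X : ModuleCat R) {K : ModuleCat R} (P : ProjectiveResolution K) :
    ((((tensoringLeft (ModuleCat R)).obj X).mapHomologicalComplex _).obj P.complex).homology 0 ≅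
      X ⊗ K :=
  haveI : Limits.PreservesFiniteColimits ((tensoringLeft (ModuleCat R)).obj X) :=
    inferInstanceAs (Limits.PreservesFiniteColimits (tensorLeft X))
  ChainComplex.isoHomologyι₀ _ ≪≫ asIso (P.fromLeftDerivedZero' ((tensoringLeft (ModuleCat R)).obj X))

theorem homologyZeroTensorIso_naturality {X Y : ModuleCat R} (f : X ⟶ Y) {K : ModuleCat R}
    (P : ProjectiveResolution K) :
    HomologicalComplex.homologyMap ((NatTrans.mapHomologicalComplex
        ((tensoringLeft (ModuleCat R)).map f) _).app P.complex) 0 ≫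
      (homologyZeroTensorIso Y P).hom = (homologyZeroTensorIso X P).hom ≫ f ▷ K := by
  have h : HomologicalComplex.opcyclesMap ((NatTrans.mapHomologicalComplex
        ((tensoringLeft (ModuleCat R)).map f) _).app P.complex) 0 ≫
      P.fromLeftDerivedZero' ((tensoringLeft (ModuleCat R)).obj Y) =
      P.fromLeftDerivedZero' ((tensoringLeft (ModuleCat R)).obj X) ≫
        ((tensoringLeft (ModuleCat R)).map f).app K := by
    rw [← cancel_epi (HomologicalComplex.pOpcycles _ _), HomologicalComplex.p_opcyclesMap_assoc,
      P.pOpcycles_comp_fromLeftDerivedZero', P.pOpcycles_comp_fromLeftDerivedZero'_assoc]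
    exact (((tensoringLeft (ModuleCat R)).map f).naturality (P.π.f 0)).symm
  refine (HomologicalComplex.homologyι_naturality_assoc ((NatTrans.mapHomologicalComplex
    ((tensoringLeft (ModuleCat R)).map f) _).app P.complex) 0 _).trans ?_
  exact (congrArg (_ ≫ ·) h).trans (Category.assoc _ _ _).symm

theorem nonempty_Tor_one_iso {S : ShortComplex (ModuleCat R)} (hS : S.ShortExact)
    [Module.Flat R S.X₂] (K : ModuleCat R) (h₀ : S.f ▷ K = 0) :
    Nonempty (((Tor (ModuleCat R) 1).obj S.X₃).obj K ≅ S.X₁ ⊗ K) := by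
  let P := projectiveResolution K
  have h := tensorShortComplex_shortExact hS P
  have hz : HomologicalComplex.homologyMap (tensorShortComplex S P.complex).f 0 = 0 := by
    rw [← cancel_mono (homologyZeroTensorIso S.X₂ P).hom]
    refine (homologyZeroTensorIso_naturality S.f P).trans ?_
    rw [h₀, Limits.comp_zero, Limits.zero_comp]
  have hm : Mono (h.δ 1 0 rfl) := h.mono_δ 1 0 rfl (isZero_homology_tensor_of_flat S.X₂ P 0)
  have he : Epi (h.δ 1 0 rfl) := (h.homology_exact₁ 1 0 rfl).epi_f hz
  have hi : IsIso (h.δ 1 0 rfl) := @isIso_of_mono_of_epi _ _ _ _ _ _ hm he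
  exact ⟨P.isoLeftDerivedObj _ _ ≪≫ @asIso _ _ _ _ (h.δ 1 0 rfl) hi ≪≫ homologyZeroTensorIso S.X₁ P⟩

end TorShift

section MinimalPresentation

open TensorProduct

variable {R : Type} [CommRing R]

/-- `X` has a presentation `0 → A → R^κ → X → 0` in which the image of `A` lies in `I R^κ`. -/
def HasMinimalPresentation (I : Ideal R) (A κ X : Type) [AddCommGroup A] [Module R A]
    [AddCommGroup X] [Module R X] : Prop :=
  ∃ (f : A →ₗ[R] (κ → R)) (g : (κ → R) →ₗ[R] X), Function.Injective f ∧ Function.Exact f g ∧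
    Function.Surjective g ∧ ∀ a t, f a t ∈ I

namespace HasMinimalPresentation

variable {I : Ideal R} {A κ X A' X' : Type} [AddCommGroup A] [Module R A]
  [AddCommGroup X] [Module R X] [AddCommGroup A'] [Module R A'] [AddCommGroup X'] [Module R X']

theorem congr (h : HasMinimalPresentation I A κ X) (eA : A ≃ₗ[R] A') (eX : X ≃ₗ[R] X') :
    HasMinimalPresentation I A' κ X' := by
  obtain ⟨f, g, hf, hfg, hg, hI⟩ := h
  refine ⟨f ∘ₗ eA.symm.toLinearMap, eX.toLinearMap ∘ₗ g, hf.comp eA.symm.injective, ?_,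
    eX.surjective.comp hg, fun a t => hI _ t⟩
  intro y
  simp only [LinearMap.comp_apply, LinearEquiv.coe_coe, LinearEquiv.map_eq_zero_iff, hfg y,
    Set.mem_range]
  exact ⟨fun ⟨x, hx⟩ => ⟨eA x, by simpa using hx⟩, fun ⟨x, hx⟩ => ⟨eA.symm x, hx⟩⟩

theorem pi {T : Type} {A κ X : T → Type} [∀ t, AddCommGroup (A t)] [∀ t, Module R (A t)]
    [∀ t, AddCommGroup (X t)] [∀ t, Module R (X t)]
    (h : ∀ t, HasMinimalPresentation I (A t) (κ t) (X t)) :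
    HasMinimalPresentation I (∀ t, A t) (Σ t, κ t) (∀ t, X t) := by
  choose f g hf hfg hg hI using h
  refine ⟨LinearMap.pi fun s => LinearMap.proj s.2 ∘ₗ f s.1 ∘ₗ LinearMap.proj s.1,
    LinearMap.pi fun t => g t ∘ₗ LinearMap.pi fun c => LinearMap.proj ⟨t, c⟩, ?_, ?_, ?_,
    fun a s => hI _ _ _⟩
  · intro a b hab
    funext t
    exact hf t (funext fun c => congrFun hab ⟨t, c⟩)
  · intro y
    constructor
    · intro hy
      choose a ha using fun t => (hfg t fun c => y ⟨t, c⟩).1 (congrFun hy t)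
      exact ⟨a, funext fun s => congrFun (ha s.1) s.2⟩
    · rintro ⟨a, rfl⟩
      funext t
      exact (hfg t _).2 ⟨a t, rfl⟩
  · intro x
    choose y hy using fun t => hg t (x t)
    exact ⟨fun s => y s.1 s.2, funext hy⟩

theorem rTensor_eq_zero {κ : Type} [Finite κ] {f : A →ₗ[R] (κ → R)} (hI : ∀ a t, f a t ∈ I) :
    f.rTensor (R ⧸ I) = 0 := by
  cases nonempty_fintype κ
  classical
  refine TensorProduct.ext' fun a c => ?_
  rw [LinearMap.rTensor_tmul, LinearMap.zero_apply, pi_eq_sum_univ' (f a), TensorProduct.sum_tmul]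
  refine Finset.sum_eq_zero fun t _ => ?_
  obtain ⟨r, rfl⟩ := Ideal.Quotient.mk_surjective c
  rw [TensorProduct.smul_tmul, Algebra.smul_def, Ideal.Quotient.algebraMap_eq,
    Ideal.Quotient.eq_zero_iff_mem.2 (hI a t), zero_mul, TensorProduct.tmul_zero]

/-- The fibre of a module with a minimal presentation is free on the generators. -/
theorem nonempty_tensor_equiv [Finite κ] (h : HasMinimalPresentation I A κ X) :
    Nonempty (X ⊗[R] (R ⧸ I) ≃ₗ[R] (κ → R ⧸ I)) := by
  cases nonempty_fintype κ
  classical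
  obtain ⟨f, g, -, hfg, hg, hI⟩ := h
  have hex := rTensor_exact (R ⧸ I) hfg hg
  rw [rTensor_eq_zero hI] at hex
  have hinj : Function.Injective (g.rTensor (R ⧸ I)) := by
    rw [injective_iff_map_eq_zero]
    intro y hy
    obtain ⟨x, hx⟩ := (hex y).1 hy
    exact hx.symm
  exact ⟨(LinearEquiv.ofBijective _ ⟨hinj, LinearMap.rTensor_surjective _ hg⟩).symm ≪≫ₗ
    TensorProduct.comm R _ _ ≪≫ₗ TensorProduct.piScalarRight R R _ κ⟩

theorem nonempty_Tor_succ_succ_equiv [Finite κ] (h : HasMinimalPresentation I A κ X) (n : ℕ) :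
    Nonempty (((Tor (ModuleCat R) (n + 2)).obj (ModuleCat.of R X)).obj (ModuleCat.of R (R ⧸ I))
      ≃ₗ[R] ((Tor (ModuleCat R) (n + 1)).obj (ModuleCat.of R A)).obj
        (ModuleCat.of R (R ⧸ I))) := by
  obtain ⟨f, g, hf, hfg, hg, hI⟩ := h
  let S : ShortComplex (ModuleCat R) :=
    ModuleCat.shortComplexOfCompEqZero f g hfg.linearMap_comp_eq_zero
  have hS : S.ShortExact := ModuleCat.shortComplex_shortExact S hfg hf hg
  have : Module.Flat R S.X₂ := inferInstanceAs (Module.Flat R (κ → R))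
  exact (nonempty_Tor_succ_succ_iso hS (ModuleCat.of R (R ⧸ I)) n).map Iso.toLinearEquiv

theorem nonempty_Tor_one_equiv [Finite κ] (h : HasMinimalPresentation I A κ X) :
    Nonempty (((Tor (ModuleCat R) 1).obj (ModuleCat.of R X)).obj (ModuleCat.of R (R ⧸ I))
      ≃ₗ[R] A ⊗[R] (R ⧸ I)) := by
  obtain ⟨f, g, hf, hfg, hg, hI⟩ := h
  let S : ShortComplex (ModuleCat R) :=
    ModuleCat.shortComplexOfCompEqZero f g hfg.linearMap_comp_eq_zero
  have hS : S.ShortExact := ModuleCat.shortComplex_shortExact S hfg hf hg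
  have : Module.Flat R S.X₂ := inferInstanceAs (Module.Flat R (κ → R))
  exact (nonempty_Tor_one_iso hS (ModuleCat.of R (R ⧸ I))
    (ModuleCat.hom_ext (rTensor_eq_zero hI))).map Iso.toLinearEquiv

end HasMinimalPresentation

theorem finrank_restrictScalars_congr (k : Type) [Field k] [Algebra k R] {N N' : Type}
    [AddCommGroup N] [Module R N] [AddCommGroup N'] [Module R N'] (e : N ≃ₗ[R] N') :
    Module.finrank k (RestrictScalars k R N) = Module.finrank k (RestrictScalars k R N') :=
  letI := RestrictScalars.moduleOrig k R N
  letI := RestrictScalars.moduleOrig k R N'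
  LinearEquiv.finrank_eq (LinearEquiv.restrictScalars k
    (show RestrictScalars k R N ≃ₗ[R] RestrictScalars k R N' from e))

theorem finrank_restrictScalars_pi (k : Type) [Field k] [Algebra k R] {N : Type}
    [AddCommGroup N] [Module R N] (e : RestrictScalars k R N ≃ₗ[k] k) (κ : Type) [Fintype κ] :
    Module.finrank k (RestrictScalars k R (κ → N)) = Fintype.card κ := by
  have h := LinearEquiv.finrank_eq (LinearEquiv.piCongrRight fun _ : κ => e)
  rw [Module.finrank_fintype_fun_eq_card] at h
  exact h

/-- If `M` has a minimal presentation with `β` generators and syzygy module `M^α`, then the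
Betti numbers of any module with syzygy module `M^ι` are `|ι| |β| |α|^n`. -/
theorem HasMinimalPresentation.finrank_Tor_succ (k : Type) [Field k] [Algebra k R] {I : Ideal R}
    (e : RestrictScalars k R (R ⧸ I) ≃ₗ[k] k) {M α β : Type} [AddCommGroup M] [Module R M]
    [Fintype α] [Fintype β] (hM : HasMinimalPresentation I (α → M) β M) (n : ℕ) :
    ∀ {X ι κ : Type} [AddCommGroup X] [Module R X] [Fintype ι] [Finite κ],
      HasMinimalPresentation I (ι → M) κ X →
      Module.finrank k (RestrictScalars k R
        (((Tor (ModuleCat R) (n + 1)).obj (ModuleCat.of R X)).obj (ModuleCat.of R (R ⧸ I)))) =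
        Fintype.card ι * Fintype.card β * Fintype.card α ^ n := by
  induction n with
  | zero =>
    intro X ι κ _ _ _ _ hX
    obtain ⟨e₁⟩ := hX.nonempty_Tor_one_equiv
    obtain ⟨e₂⟩ := (HasMinimalPresentation.pi fun _ : ι => hM).nonempty_tensor_equiv
    rw [finrank_restrictScalars_congr k (e₁ ≪≫ₗ e₂), finrank_restrictScalars_pi k e]
    simp
  | succ n ih =>
    intro X ι κ _ _ _ _ hX
    obtain ⟨e₁⟩ := hX.nonempty_Tor_succ_succ_equiv n
    rw [finrank_restrictScalars_congr k e₁, ih (((HasMinimalPresentation.pi fun _ : ι => hM).congr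
      (LinearEquiv.curry R M ι α).symm (LinearEquiv.refl R _))), Fintype.card_prod]
    ring

end MinimalPresentation

section Veronese

variable {k}

/-- The weight on `k[x, y]` recording the total degree modulo `δ`. -/
abbrev degreeMod (δ : ℕ) : Fin 2 → ZMod δ := fun _ => 1

theorem weight_degreeMod (δ : ℕ) (d : Fin 2 →₀ ℕ) :
    Finsupp.weight (degreeMod δ) d = ((d 0 + d 1 : ℕ) : ZMod δ) := by
  rw [Finsupp.weight_apply, Finsupp.sum_fintype _ _ (by simp)]
  simp

theorem monomial_eq_C_mul_X_pow (d : Fin 2 →₀ ℕ) (c : k) :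
    monomial d c = C c * (X 0 ^ d 0 * X 1 ^ d 1) := by
  rw [monomial_eq, Finsupp.prod_fintype _ _ (by simp), Fin.prod_univ_two]

theorem isWeightedHomogeneous_X_pow_mul_X_pow (δ u v : ℕ) :
    IsWeightedHomogeneous (degreeMod δ) (X 0 ^ u * X 1 ^ v : MvPolynomial (Fin 2) k)
      ((u + v : ℕ) : ZMod δ) := by
  have h := ((isWeightedHomogeneous_X k (degreeMod δ) 0).pow u).mul
    ((isWeightedHomogeneous_X k (degreeMod δ) 1).pow v)
  simpa using h

theorem X_pow_mul_X_pow_mem_Rver_s4 {δ : ℕ} (n : ℕ) :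
    ∀ u v : ℕ, u + v = δ * n → (X 0 ^ u * X 1 ^ v : MvPolynomial (Fin 2) k) ∈ Rver k δ := by
  induction n with
  | zero =>
    intro u v h
    obtain ⟨rfl, rfl⟩ : u = 0 ∧ v = 0 := by simpa using h
    simp
  | succ n ih =>
    intro u v h
    rw [Nat.mul_succ] at h
    obtain ⟨i, hi, hu, hv⟩ : ∃ i ≤ δ, δ - i ≤ u ∧ i ≤ v :=
      ⟨min v δ, min_le_right _ _, by omega, min_le_left _ _⟩
    obtain ⟨u', rfl⟩ := Nat.exists_eq_add_of_le hu
    obtain ⟨v', rfl⟩ := Nat.exists_eq_add_of_le hv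
    have hgen : (X 0 ^ (δ - i) * X 1 ^ i : MvPolynomial (Fin 2) k) ∈ Rver k δ :=
      Algebra.subset_adjoin ⟨i, hi, rfl⟩
    have := mul_mem hgen (ih u' v' (by omega))
    convert this using 1
    ring

theorem mem_Rver_iff {δ : ℕ} {f : MvPolynomial (Fin 2) k} :
    f ∈ Rver k δ ↔ IsWeightedHomogeneous (degreeMod δ) f 0 := by
  constructor
  · intro hf
    induction hf using Algebra.adjoin_induction with
    | mem g hg =>
      obtain ⟨i, hi, rfl⟩ := hg
      simpa [Nat.sub_add_cancel hi] using
        isWeightedHomogeneous_X_pow_mul_X_pow (k := k) δ (δ - i) i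
    | algebraMap r => exact isWeightedHomogeneous_C _ _
    | add f g _ _ hf hg => exact hf.add hg
    | mul f g _ _ hf hg => simpa using hf.mul hg
  · intro hf
    rw [f.as_sum]
    refine sum_mem fun d hd => ?_
    have hw := hf (mem_support_iff.1 hd)
    rw [weight_degreeMod, ZMod.natCast_eq_zero_iff] at hw
    obtain ⟨n, hn⟩ := hw
    rw [monomial_eq_C_mul_X_pow]
    exact mul_mem ((Rver k δ).algebraMap_mem _) (X_pow_mul_X_pow_mem_Rver_s4 n _ _ hn)

variable (k) in
/-- The module `⊕ₙ S_{nδ+a}` over the Veronese subring, for a residue class `a` modulo `δ`. -/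
def veroneseModule (δ : ℕ) (a : ZMod δ) :
    Submodule ↥(Rver k δ) (MvPolynomial (Fin 2) k) where
  carrier := {f | IsWeightedHomogeneous (degreeMod δ) f a}
  add_mem' hf hg := hf.add hg
  zero_mem' := isWeightedHomogeneous_zero _ _ _
  smul_mem' r f hf := by
    have h := (mem_Rver_iff.1 r.2).mul hf
    rw [zero_add] at h
    exact h

theorem mem_veroneseModule {δ : ℕ} {a : ZMod δ} {f : MvPolynomial (Fin 2) k} :
    f ∈ veroneseModule k δ a ↔ IsWeightedHomogeneous (degreeMod δ) f a := Iff.rfl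

/-- Multiplication by a variable, as a map `⊕ₙ S_{nδ-1} → R`. -/
def mulVariable (δ : ℕ) (s : Fin 2) : ↥(veroneseModule k δ (-1)) →ₗ[↥(Rver k δ)] ↥(Rver k δ) where
  toFun f := ⟨X s * f.1, mem_Rver_iff.2 (by
    simpa using (isWeightedHomogeneous_X k (degreeMod δ) s).mul (mem_veroneseModule.1 f.2))⟩
  map_add' f g := Subtype.ext (mul_add _ _ _)
  map_smul' r f := Subtype.ext (mul_left_comm _ _ _)

/-- The syzygies `y eᵢ - x eᵢ₊₁` of the monomials `x^(j-i) y^i`. -/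
def syzygyMap (δ j : ℕ) : (Fin j → ↥(veroneseModule k δ (-1))) →ₗ[↥(Rver k δ)]
    (Fin (j + 1) → ↥(Rver k δ)) :=
  LinearMap.pi fun i =>
    mulVariable δ 1 ∘ₗ (if h : i.1 < j then LinearMap.proj ⟨i.1, h⟩ else 0) -
    mulVariable δ 0 ∘ₗ (if h : 0 < i.1 then LinearMap.proj ⟨i.1 - 1, by omega⟩ else 0)

/-- Extension by zero of a finite sequence of polynomials. -/
def extendZero {δ j : ℕ} {a : ZMod δ} (m : Fin j → ↥(veroneseModule k δ a)) (n : ℕ) :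
    MvPolynomial (Fin 2) k :=
  if h : n < j then (m ⟨n, h⟩).1 else 0

theorem syzygyMap_zero {δ j : ℕ} (m : Fin j → ↥(veroneseModule k δ (-1))) :
    (syzygyMap δ j m 0).1 = X 1 * extendZero m 0 := by
  by_cases h : 0 < j <;> simp [syzygyMap, extendZero, mulVariable, h]

theorem syzygyMap_succ {δ j : ℕ} (m : Fin j → ↥(veroneseModule k δ (-1))) (i : ℕ) (hi : i < j) :
    (syzygyMap δ j m ⟨i + 1, by omega⟩).1 =
      X 1 * extendZero m (i + 1) - X 0 * extendZero m i := by
  have h0 : (0 : Fin (j + 1)) < ⟨i + 1, by omega⟩ := Nat.succ_pos i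
  by_cases h : i + 1 < j <;> simp [syzygyMap, extendZero, mulVariable, h, hi, h0]

theorem syzygyMap_mem (δ j : ℕ) (m : Fin j → ↥(veroneseModule k δ (-1))) (i : Fin (j + 1)) :
    syzygyMap δ j m i ∈ mIdeal k δ := by
  have h : ∀ (s : Fin 2) (f : ↥(veroneseModule k δ (-1))), mulVariable δ s f ∈ mIdeal k δ := by
    intro s f
    change constantCoeff (X s * f.1) = 0
    simp
  exact sub_mem (h _ _) (h _ _)

theorem syzygyMap_injective (δ j : ℕ) : Function.Injective (syzygyMap (k := k) δ j) := by
  rw [injective_iff_map_eq_zero]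
  intro m hm
  have key : ∀ n, extendZero m n = 0 := by
    intro n
    induction n with
    | zero =>
      have h := syzygyMap_zero m
      rw [hm] at h
      simpa [X_ne_zero] using h.symm
    | succ n ih =>
      by_cases hn : n < j
      · have h := syzygyMap_succ m n hn
        rw [hm, ih] at h
        simpa [X_ne_zero] using h.symm
      · rw [extendZero, dif_neg (by omega)]
  funext i
  have := key i
  rw [extendZero, dif_pos i.2] at this
  exact Subtype.ext this

theorem exists_syzygy (j : ℕ) : ∀ r : ℕ → MvPolynomial (Fin 2) k,
    ∑ i ∈ Finset.range (j + 1), r i * (X 0 ^ (j - i) * X 1 ^ i) = 0 →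
    ∃ m : ℕ → MvPolynomial (Fin 2) k, m j = 0 ∧ r 0 = X 1 * m 0 ∧
      ∀ i < j, r (i + 1) = X 1 * m (i + 1) - X 0 * m i := by
  induction j with
  | zero =>
    intro r h
    exact ⟨fun _ => 0, rfl, by simpa using h, fun i hi => absurd hi (Nat.not_lt_zero i)⟩
  | succ j ih =>
    intro r h
    rw [Finset.sum_range_succ'] at h
    have h1 : ∑ i ∈ Finset.range (j + 1),
        r (i + 1) * (X 0 ^ (j + 1 - (i + 1)) * X 1 ^ (i + 1) : MvPolynomial (Fin 2) k) =
        X 1 * ∑ i ∈ Finset.range (j + 1), r (i + 1) * (X 0 ^ (j - i) * X 1 ^ i) := by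
      rw [Finset.mul_sum]
      refine Finset.sum_congr rfl fun i _ => ?_
      rw [Nat.add_sub_add_right]
      ring
    rw [h1] at h
    have h2 : r 0 * X 0 ^ (j + 1) =
        X 1 * -∑ i ∈ Finset.range (j + 1), r (i + 1) * (X 0 ^ (j - i) * X 1 ^ i) := by
      rw [mul_neg, ← eq_neg_of_add_eq_zero_right h, Nat.sub_zero, pow_zero, mul_one]
    obtain ⟨m₀, hm₀⟩ : (X 1 : MvPolynomial (Fin 2) k) ∣ r 0 :=
      (X_prime.dvd_or_dvd (Dvd.intro _ h2.symm)).resolve_right fun h' => by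
        simpa [X_dvd_X] using X_prime.dvd_of_dvd_pow h'
    let r' : ℕ → MvPolynomial (Fin 2) k := fun n =>
      Nat.casesOn n (r 1 + X 0 * m₀) fun n => r (n + 2)
    have h3 : (X 1 : MvPolynomial (Fin 2) k) *
        ∑ i ∈ Finset.range (j + 1), r' i * (X 0 ^ (j - i) * X 1 ^ i) = X 1 * 0 := by
      rw [Finset.sum_range_succ', hm₀] at h
      rw [Finset.sum_range_succ', mul_zero, ← h]
      change X 1 * (∑ i ∈ Finset.range j, r (i + 2) * (X 0 ^ (j - (i + 1)) * X 1 ^ (i + 1)) +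
        (r 1 + X 0 * m₀) * (X 0 ^ (j - 0) * X 1 ^ 0)) = _
      simp only [Nat.sub_zero, zero_add]
      ring
    obtain ⟨m, hmj, hm0, hm⟩ := ih r' (mul_left_cancel₀ (X_ne_zero 1) h3)
    let m' : ℕ → MvPolynomial (Fin 2) k := fun n => Nat.casesOn n m₀ m
    refine ⟨m', hmj, hm₀, ?_⟩
    rintro (_ | i) hi
    · exact eq_sub_of_add_eq hm0
    · exact hm i (Nat.lt_of_succ_lt_succ hi)

theorem sum_syzygy {j : ℕ} {r m : ℕ → MvPolynomial (Fin 2) k} (h0 : r 0 = X 1 * m 0)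
    (hm : ∀ i < j, r (i + 1) = X 1 * m (i + 1) - X 0 * m i) (n : ℕ) (hn : n ≤ j) :
    ∑ i ∈ Finset.range (n + 1), r i * (X 0 ^ (j - i) * X 1 ^ i) =
      m n * (X 0 ^ (j - n) * X 1 ^ (n + 1)) := by
  induction n with
  | zero =>
    simp [h0]
    ring
  | succ n ih =>
    rw [Finset.sum_range_succ, ih (by omega), hm n hn]
    obtain ⟨l, rfl⟩ := Nat.exists_eq_add_of_le hn
    rw [show n + 1 + l - n = l + 1 by omega, show n + 1 + l - (n + 1) = l by omega]
    ring

/-- The surjection `R^(j+1) → ⊕ₙ S_{nδ+j}` given by the monomials of degree `j`. -/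
def monomialMap (δ j : ℕ) : (Fin (j + 1) → ↥(Rver k δ)) →ₗ[↥(Rver k δ)]
    ↥(veroneseModule k δ (j : ZMod δ)) :=
  Fintype.linearCombination ↥(Rver k δ) fun i : Fin (j + 1) =>
    (⟨X 0 ^ (j - i.1) * X 1 ^ i.1, by
      have h := isWeightedHomogeneous_X_pow_mul_X_pow (k := k) δ (j - i.1) i.1
      rwa [Nat.sub_add_cancel (Nat.lt_succ_iff.1 i.2)] at h⟩ : ↥(veroneseModule k δ (j : ZMod δ)))

theorem monomialMap_apply (δ j : ℕ) (r : Fin (j + 1) → ↥(Rver k δ)) :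
    (monomialMap δ j r).1 = ∑ i : Fin (j + 1), (r i).1 * (X 0 ^ (j - i.1) * X 1 ^ i.1) := by
  rw [monomialMap, Fintype.linearCombination_apply, AddSubmonoidClass.coe_finsetSum]
  rfl

theorem monomialMap_surjective {δ j : ℕ} (hj : j < δ) :
    Function.Surjective (monomialMap (k := k) δ j) := by
  classical
  rintro ⟨f, hf⟩
  have key : ∀ d ∈ f.support, ∃ r, (monomialMap (k := k) δ j r).1 = monomial d (f.coeff d) := by
    intro d hd
    have hw := hf (mem_support_iff.1 hd)
    rw [weight_degreeMod, ZMod.natCast_eq_natCast_iff', Nat.mod_eq_of_lt hj] at hw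
    have hle : j ≤ d 0 + d 1 := hw ▸ Nat.mod_le _ _
    obtain ⟨i, hi, hu, hv⟩ : ∃ i < j + 1, j - i ≤ d 0 ∧ i ≤ d 1 :=
      ⟨min (d 1) j, by omega, by omega, by omega⟩
    obtain ⟨u, hu⟩ := Nat.exists_eq_add_of_le hu
    obtain ⟨v, hv⟩ := Nat.exists_eq_add_of_le hv
    have hdiv : u + v = δ * ((d 0 + d 1) / δ) := by
      have := Nat.div_add_mod (d 0 + d 1) δ
      omega
    have hmem : C (f.coeff d) * (X 0 ^ u * X 1 ^ v) ∈ Rver k δ :=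
      mul_mem ((Rver k δ).algebraMap_mem _) (X_pow_mul_X_pow_mem_Rver_s4 _ _ _ hdiv)
    refine ⟨Pi.single ⟨i, hi⟩ ⟨_, hmem⟩, ?_⟩
    rw [monomialMap_apply, Finset.sum_eq_single ⟨i, hi⟩, Pi.single_eq_same,
      monomial_eq_C_mul_X_pow, hu, hv]
    · ring
    · intro b _ hb
      rw [Pi.single_eq_of_ne hb]
      exact zero_mul _
    · simp
  choose! r hr using key
  refine ⟨∑ d ∈ f.support, r d, Subtype.ext ?_⟩
  rw [map_sum, AddSubmonoidClass.coe_finsetSum, Finset.sum_congr rfl hr]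
  exact f.as_sum.symm

theorem extendZero_restrict {δ j : ℕ} {m : ℕ → MvPolynomial (Fin 2) k} {a : ZMod δ}
    (hm : ∀ n, m n ∈ veroneseModule k δ a) (hj : m j = 0) {n : ℕ} (hn : n ≤ j) :
    extendZero (fun i : Fin j => (⟨m i, hm i⟩ : ↥(veroneseModule k δ a))) n = m n := by
  rcases hn.lt_or_eq with h | rfl
  · rw [extendZero, dif_pos h]
  · rw [extendZero, dif_neg (lt_irrefl _), hj]

theorem mem_veroneseModule_of_X_mul {δ : ℕ} {f : MvPolynomial (Fin 2) k}
    (hf : X 1 * f ∈ Rver k δ) : f ∈ veroneseModule k δ (-1) := by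
  intro d hd
  have h := mem_Rver_iff.1 hf (d := Finsupp.single 1 1 + d) (by rwa [coeff_X_mul])
  rw [map_add, Finsupp.weight_single] at h
  simpa [degreeMod] using eq_neg_of_add_eq_zero_right h

theorem exact_syzygyMap_monomialMap (δ j : ℕ) :
    Function.Exact (syzygyMap (k := k) δ j) (monomialMap δ j) := by
  intro r
  let r' : ℕ → MvPolynomial (Fin 2) k := fun n => if h : n < j + 1 then (r ⟨n, h⟩).1 else 0
  have hr' : ∀ i : Fin (j + 1), r' i = (r i).1 := fun i => dif_pos i.2
  have hr'mem : ∀ n, r' n ∈ Rver k δ := by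
    intro n
    by_cases h : n < j + 1
    · rw [hr' ⟨n, h⟩]
      exact (r _).2
    · simp only [r', dif_neg h, zero_mem]
  have hsum : (monomialMap δ j r).1 =
      ∑ i ∈ Finset.range (j + 1), r' i * (X 0 ^ (j - i) * X 1 ^ i) := by
    rw [monomialMap_apply, Finset.sum_range]
    exact Finset.sum_congr rfl fun i _ => by rw [hr']
  constructor
  · intro h
    rw [h] at hsum
    obtain ⟨m, hmj, hm0, hm⟩ := exists_syzygy j r' hsum.symm
    let m' : ℕ → MvPolynomial (Fin 2) k := fun n => if n < j then m n else 0
    have hm' : ∀ n ≤ j, m' n = m n := by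
      intro n hn
      rcases hn.lt_or_eq with h | rfl
      · simp only [m', if_pos h]
      · simp only [m', lt_irrefl, if_false, hmj]
    have hmem' : ∀ n ≤ j, m n ∈ veroneseModule k δ (-1) := by
      intro n
      induction n with
      | zero => exact fun _ => mem_veroneseModule_of_X_mul (hm0 ▸ hr'mem 0)
      | succ n ih =>
        intro hn
        refine mem_veroneseModule_of_X_mul ?_
        rw [show X 1 * m (n + 1) = r' (n + 1) + X 0 * m n by rw [hm n hn, sub_add_cancel]]
        exact add_mem (hr'mem _) (mulVariable δ 0 ⟨m n, ih (by omega)⟩).2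
    have hmem : ∀ n, m' n ∈ veroneseModule k δ (-1) := by
      intro n
      by_cases hn : n < j
      · simpa only [m', if_pos hn] using hmem' n hn.le
      · simp only [m', if_neg hn, zero_mem]
    have hext : ∀ n ≤ j, extendZero (fun i : Fin j =>
        (⟨m' i, hmem i⟩ : ↥(veroneseModule k δ (-1)))) n = m n := fun n hn => by
      rw [extendZero_restrict hmem (by rw [hm' j le_rfl, hmj]) hn, hm' n hn]
    refine ⟨fun i => ⟨m' i, hmem i⟩, funext fun ⟨i, hi⟩ => Subtype.ext ?_⟩
    rw [← hr' ⟨i, hi⟩]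
    rcases i with _ | i
    · exact (syzygyMap_zero _).trans (by rw [hext 0 (by omega), hm0])
    · exact (syzygyMap_succ _ i (by omega)).trans
        (by rw [hext _ (by omega), hext _ (by omega), hm i (by omega)])
  · rintro ⟨m, rfl⟩
    refine Subtype.ext (hsum.trans ?_)
    rw [sum_syzygy (m := extendZero m) _ _ j le_rfl, extendZero, dif_neg (lt_irrefl _), zero_mul]
    · rfl
    · rw [← syzygyMap_zero, ← hr' 0]
      rfl
    · intro i hi
      rw [← syzygyMap_succ m i hi, ← hr' ⟨i + 1, by omega⟩]

theorem veroneseModule_hasMinimalPresentation {δ j : ℕ} (hj : j < δ) :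
    HasMinimalPresentation (mIdeal k δ) (Fin j → ↥(veroneseModule k δ (-1))) (Fin (j + 1))
      ↥(veroneseModule k δ (j : ZMod δ)) :=
  ⟨syzygyMap δ j, monomialMap δ j, syzygyMap_injective δ j, exact_syzygyMap_monomialMap δ j,
    monomialMap_surjective hj, fun m i => syzygyMap_mem δ j m i⟩

variable (k) in
theorem nonempty_residueField_equiv (δ : ℕ) :
    Nonempty (RestrictScalars k ↥(Rver k δ) (↥(Rver k δ) ⧸ mIdeal k δ) ≃ₗ[k] k) := by
  let φ : ↥(Rver k δ) →+* k :=
    (constantCoeff : MvPolynomial (Fin 2) k →+* k).comp (Rver k δ).val.toRingHom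
  have hφ : Function.Surjective φ := fun c => ⟨algebraMap k _ c, constantCoeff_C _ c⟩
  let e : (↥(Rver k δ) ⧸ mIdeal k δ) ≃+* k := RingHom.quotientKerEquivOfSurjective hφ
  refine ⟨{ (e.toAddEquiv : (↥(Rver k δ) ⧸ mIdeal k δ) ≃+ k) with map_smul' := ?_ }⟩
  intro c x
  obtain ⟨r, rfl⟩ := Ideal.Quotient.mk_surjective (I := mIdeal k δ) x
  change φ (algebraMap k _ c * r) = c * φ r
  rw [map_mul]
  congr 1
  exact constantCoeff_C _ c

/-- Remainders `(a, b)` modulo `q` and a residue `j` modulo `δ` such that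
`m ^ q * (x ^ a * y ^ b)` has degree divisible by `δ` when `m` has degree `j` modulo `δ`. -/
abbrev FrobeniusIndex (δ q : ℕ) : Type :=
  {t : (Fin q × Fin q) × Fin δ // ((t.1.1 + t.1.2 + q * t.2 : ℕ) : ZMod δ) = 0}

section Frobenius

variable (p : ℕ) [Fact p.Prime] [CharP k p] (e : ℕ)

theorem coeff_pow_char_pow (g : MvPolynomial (Fin 2) k) (d : Fin 2 →₀ ℕ) :
    coeff (p ^ e • d) (g ^ p ^ e) = coeff d g ^ p ^ e := by
  have hq : p ^ e ≠ 0 := pow_ne_zero e (Fact.out : p.Prime).ne_zero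
  rw [← map_iterateFrobenius_expand, coeff_map, coeff_expand_smul _ hq, iterateFrobenius_def]

theorem coeff_pow_char_pow_of_not_dvd (g : MvPolynomial (Fin 2) k) {d : Fin 2 →₀ ℕ}
    {i : Fin 2} (hd : ¬ p ^ e ∣ d i) : coeff d (g ^ p ^ e) = 0 := by
  rw [← map_iterateFrobenius_expand, coeff_map, coeff_expand_of_not_dvd _ hd, map_zero]

theorem coeff_pow_mul_monomial {s s' : Fin 2 →₀ ℕ} (hs : ∀ i, s i < p ^ e)
    (hs' : ∀ i, s' i < p ^ e) (g : MvPolynomial (Fin 2) k) (d : Fin 2 →₀ ℕ) :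
    coeff (p ^ e • d + s) (g ^ p ^ e * monomial s' 1) =
      if s = s' then coeff d g ^ p ^ e else 0 := by
  split_ifs with h
  · rw [h, coeff_mul_monomial, mul_one, coeff_pow_char_pow]
  · rw [coeff_mul_monomial']
    split_ifs with hle
    · obtain ⟨i, hi⟩ : ∃ i, s i ≠ s' i := not_forall.1 (mt Finsupp.ext h)
      rw [coeff_pow_char_pow_of_not_dvd p e g (i := i), zero_mul]
      have hlei : s' i ≤ p ^ e * d i + s i := hle i
      rw [Finsupp.tsub_apply, Finsupp.add_apply, Finsupp.smul_apply, smul_eq_mul]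
      rintro ⟨c, hc⟩
      have h1 : p ^ e * d i + s i = p ^ e * c + s' i := by omega
      have h2 := congrArg (· % p ^ e) h1
      simp only [Nat.mul_add_mod, Nat.mod_eq_of_lt (hs i), Nat.mod_eq_of_lt (hs' i)] at h2
      exact hi h2
    · rfl

/-- The exponent `(a, b)` as a finitely supported function. -/
def exponentPair (a b : ℕ) : Fin 2 →₀ ℕ := Finsupp.single 0 a + Finsupp.single 1 b

theorem exponentPair_zero (a b : ℕ) : exponentPair a b 0 = a := by simp [exponentPair]

theorem exponentPair_one (a b : ℕ) : exponentPair a b 1 = b := by simp [exponentPair]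

/-- The exponent `(a, b)` of the basis element of an index. -/
abbrev FrobeniusIndex.exponent {δ q : ℕ} (t : FrobeniusIndex δ q) : Fin 2 →₀ ℕ :=
  exponentPair t.1.1.1 t.1.1.2

theorem FrobeniusIndex.exponent_lt {δ q : ℕ} (t : FrobeniusIndex δ q) (i : Fin 2) :
    t.exponent i < q := by
  fin_cases i
  · exact (exponentPair_zero _ _).trans_lt t.1.1.1.2
  · exact (exponentPair_one _ _).trans_lt t.1.1.2.2

theorem FrobeniusIndex.eq_of_exponent_eq {δ q : ℕ} {t t' : FrobeniusIndex δ q}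
    (h : t.exponent = t'.exponent) (hj : t.1.2 = t'.1.2) : t = t' := by
  have h0 := DFunLike.congr_fun h 0
  have h1 := DFunLike.congr_fun h 1
  rw [exponentPair_zero, exponentPair_zero] at h0
  rw [exponentPair_one, exponentPair_one] at h1
  exact Subtype.ext (Prod.ext (Prod.ext (Fin.ext h0) (Fin.ext h1)) hj)

theorem pow_mul_monomial_mem_Rver {δ q : ℕ} (t : FrobeniusIndex δ q)
    (m : ↥(veroneseModule k δ ((t.1.2 : ℕ) : ZMod δ))) :
    m.1 ^ q * monomial t.exponent 1 ∈ Rver k δ := by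
  have h := ((mem_veroneseModule.1 m.2).pow q).mul
    (isWeightedHomogeneous_X_pow_mul_X_pow (k := k) δ t.1.1.1 t.1.1.2)
  rw [monomial_eq_C_mul_X_pow, C_1, one_mul, exponentPair_zero, exponentPair_one, mem_Rver_iff]
  have ht := t.2
  push_cast at ht
  convert h using 1
  rw [nsmul_eq_mul, Nat.cast_add, add_comm]
  exact ht.symm

/-- The decomposition of `^eR` into the modules `⊕ₙ S_{nδ+j}`, as a map out of their product. -/
def frobeniusDecomposition (δ : ℕ) :
    (∀ t : FrobeniusIndex δ (p ^ e), ↥(veroneseModule k δ ((t.1.2 : ℕ) : ZMod δ)))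
      →ₗ[↥(Rver k δ)] ↥(eR k δ p e) where
  toFun m := (∑ t, ⟨_, pow_mul_monomial_mem_Rver t (m t)⟩ : ↥(Rver k δ))
  map_add' m m' := by
    refine (Finset.sum_congr rfl fun t _ => ?_).trans Finset.sum_add_distrib
    refine Subtype.ext ?_
    change ((m t).1 + (m' t).1) ^ p ^ e * _ = _
    rw [add_pow_char_pow, add_mul]
    rfl
  map_smul' r m := by
    refine (Finset.sum_congr rfl fun t _ => ?_).trans (Finset.mul_sum _ _ (r ^ p ^ e)).symm
    refine Subtype.ext ?_
    change (r.1 * (m t).1) ^ p ^ e * _ = _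
    rw [mul_pow, mul_assoc]
    rfl

theorem frobeniusDecomposition_apply (δ : ℕ)
    (m : ∀ t : FrobeniusIndex δ (p ^ e), ↥(veroneseModule k δ ((t.1.2 : ℕ) : ZMod δ))) :
    (show ↥(Rver k δ) from frobeniusDecomposition p e δ m).1 =
      ∑ t, (m t).1 ^ p ^ e * monomial t.exponent 1 :=
  AddSubmonoidClass.coe_finsetSum _ _

theorem frobeniusDecomposition_injective (δ : ℕ) :
    Function.Injective (frobeniusDecomposition (k := k) p e δ) := by
  rw [injective_iff_map_eq_zero]
  intro m hm
  have hq : p ^ e ≠ 0 := pow_ne_zero e (Fact.out : p.Prime).ne_zero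
  have hsum := frobeniusDecomposition_apply p e δ m
  rw [hm] at hsum
  refine funext fun t => Subtype.ext (MvPolynomial.ext _ _ fun d => ?_)
  change coeff d (m t).1 = 0
  by_contra hd
  have hw := (mem_veroneseModule.1 (m t).2) hd
  have h := congrArg (coeff (p ^ e • d + t.exponent)) hsum
  rw [coeff_sum, Finset.sum_eq_single t, coeff_pow_mul_monomial p e t.exponent_lt t.exponent_lt,
    if_pos rfl] at h
  · exact hd ((pow_eq_zero_iff hq).1 h.symm)
  · intro t' _ ht'
    rw [coeff_pow_mul_monomial p e t.exponent_lt t'.exponent_lt]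
    split_ifs with hs
    · by_cases hd' : coeff d (m t').1 = 0
      · rw [hd', zero_pow hq]
      · have hw' := (mem_veroneseModule.1 (m t').2) hd'
        rw [hw, ZMod.natCast_eq_natCast_iff', Nat.mod_eq_of_lt t.1.2.2,
          Nat.mod_eq_of_lt t'.1.2.2] at hw'
        exact absurd (FrobeniusIndex.eq_of_exponent_eq hs (Fin.ext hw')).symm ht'
    · rfl
  · simp

theorem frobeniusDecomposition_surjective [IsAlgClosed k] {δ : ℕ} (hδ : 0 < δ) :
    Function.Surjective (frobeniusDecomposition (k := k) p e δ) := by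
  classical
  have hq : 0 < p ^ e := pow_pos (Fact.out : p.Prime).pos e
  intro f
  change ↥(Rver k δ) at f
  have key : ∀ d ∈ f.1.support, ∃ m, (show ↥(Rver k δ) from
      frobeniusDecomposition (k := k) p e δ m).1 = monomial d (f.1.coeff d) := by
    intro d hd
    have hw := mem_Rver_iff.1 f.2 (mem_support_iff.1 hd)
    rw [weight_degreeMod] at hw
    obtain ⟨c, hc⟩ := IsAlgClosed.exists_pow_nat_eq (f.1.coeff d) hq
    have hu := Nat.div_add_mod (d 0) (p ^ e)
    have hv := Nat.div_add_mod (d 1) (p ^ e)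
    let t : FrobeniusIndex δ (p ^ e) :=
      ⟨((⟨d 0 % p ^ e, Nat.mod_lt _ hq⟩, ⟨d 1 % p ^ e, Nat.mod_lt _ hq⟩),
        ⟨(d 0 / p ^ e + d 1 / p ^ e) % δ, Nat.mod_lt _ hδ⟩), by
        rw [← hw, Nat.cast_add, Nat.cast_mul, ZMod.natCast_mod, ← Nat.cast_mul, ← Nat.cast_add]
        congr 1
        rw [Nat.mul_add]
        change d 0 % p ^ e + d 1 % p ^ e + _ = _
        omega⟩
    have hmem : C c * (X 0 ^ (d 0 / p ^ e) * X 1 ^ (d 1 / p ^ e)) ∈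
        veroneseModule k δ ((t.1.2 : ℕ) : ZMod δ) := by
      have h := (isWeightedHomogeneous_C (degreeMod δ) c).mul
        (isWeightedHomogeneous_X_pow_mul_X_pow (k := k) δ (d 0 / p ^ e) (d 1 / p ^ e))
      rwa [zero_add, ← ZMod.natCast_mod] at h
    refine ⟨Pi.single t ⟨_, hmem⟩, ?_⟩
    rw [frobeniusDecomposition_apply, Finset.sum_eq_single t, Pi.single_eq_same,
      monomial_eq_C_mul_X_pow, monomial_eq_C_mul_X_pow, exponentPair_zero, exponentPair_one,
      mul_pow, ← C_pow, hc]
    · change _ * (C 1 * (X 0 ^ (d 0 % p ^ e) * X 1 ^ (d 1 % p ^ e))) = _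
      conv_rhs => rw [← hu, ← hv]
      rw [C_1]
      ring
    · intro b _ hb
      rw [Pi.single_eq_of_ne hb]
      change (0 : MvPolynomial (Fin 2) k) ^ p ^ e * _ = 0
      rw [zero_pow hq.ne', zero_mul]
    · simp
  choose! r hr using key
  refine ⟨∑ d ∈ f.1.support, r d, Subtype.ext ?_⟩
  rw [map_sum]
  refine (AddSubmonoidClass.coe_finsetSum (S := Rver k δ) _ _).trans
    ((Finset.sum_congr rfl hr).trans f.1.as_sum.symm)

theorem eR_hasMinimalPresentation [IsAlgClosed k] {δ : ℕ} (hδ : 0 < δ) :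
    HasMinimalPresentation (mIdeal k δ)
      ((Σ t : FrobeniusIndex δ (p ^ e), Fin t.1.2) → ↥(veroneseModule k δ (-1)))
      (Σ t : FrobeniusIndex δ (p ^ e), Fin (t.1.2 + 1)) ↥(eR k δ p e) :=
  (HasMinimalPresentation.pi fun t : FrobeniusIndex δ (p ^ e) =>
      veroneseModule_hasMinimalPresentation (k := k) t.1.2.2).congr
    (LinearEquiv.piCurry ↥(Rver k δ) fun (t : FrobeniusIndex δ (p ^ e)) (_ : Fin t.1.2) =>
      ↥(veroneseModule k δ (-1))).symm
    (LinearEquiv.ofBijective (frobeniusDecomposition p e δ)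
      ⟨frobeniusDecomposition_injective p e δ, frobeniusDecomposition_surjective p e hδ⟩)

variable (k) in
theorem betti_eR [IsAlgClosed k] {δ : ℕ} (hδ : 0 < δ) (n : ℕ) :
    betti k δ (n + 1) ↥(eR k δ p e) =
      (∑ t : FrobeniusIndex δ (p ^ e), (t.1.2 : ℕ)) * δ * (δ - 1) ^ n := by
  have hcast : ((δ - 1 : ℕ) : ZMod δ) = -1 := by
    rw [Nat.cast_pred hδ, CharP.cast_eq_zero, zero_sub]
  obtain ⟨ε⟩ := nonempty_residueField_equiv k δ
  have hM := veroneseModule_hasMinimalPresentation (k := k) (Nat.sub_lt hδ one_pos)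
  rw [hcast] at hM
  refine (hM.finrank_Tor_succ k ε n (eR_hasMinimalPresentation p e hδ)).trans ?_
  simp only [Fintype.card_sigma, Fintype.card_fin, Nat.sub_one_add_one hδ.ne']

end Frobenius

theorem abs_card_sub_div_le_one {δ : ℕ} (hδ : 0 < δ) (q c : ℕ) :
    |(Finset.card {b : Fin q | ((c + b : ℕ) : ZMod δ) = 0} : ℝ) - q / δ| ≤ 1 := by
  have : NeZero δ := ⟨hδ.ne'⟩
  have hcard : Finset.card {b : Fin q | ((c + b : ℕ) : ZMod δ) = 0} =
      q.count (· ≡ (-(c : ZMod δ)).val [MOD δ]) := by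
    rw [Nat.count_eq_card_filter_range, Finset.card_filter, Finset.card_filter,
      Fin.sum_univ_eq_sum_range fun b => if ((c + b : ℕ) : ZMod δ) = 0 then 1 else 0]
    refine Finset.sum_congr rfl fun b _ => if_congr ?_ rfl rfl
    rw [← ZMod.natCast_eq_natCast_iff, ZMod.natCast_zmod_val, Nat.cast_add, add_comm,
      eq_neg_iff_add_eq_zero]
  rw [hcard, Nat.count_modEq_card _ hδ]
  have h1 := Nat.div_add_mod q δ
  have h2 := Nat.mod_lt q hδ
  have hδ' : (0 : ℝ) < δ := Nat.cast_pos.2 hδ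
  have h3 : (q : ℝ) / δ = (q / δ : ℕ) + (q % δ : ℕ) / δ := by
    conv_lhs => rw [← h1]
    push_cast
    field_simp
  have h4 : ((q % δ : ℕ) : ℝ) / δ ≤ 1 := by
    rw [div_le_one hδ']
    exact_mod_cast h2.le
  have h5 : (0 : ℝ) ≤ ((q % δ : ℕ) : ℝ) / δ := by positivity
  rw [h3, abs_le]
  push_cast
  split_ifs <;> constructor <;> linarith

theorem sum_frobeniusIndex (δ q : ℕ) :
    ∑ t : FrobeniusIndex δ q, (t.1.2 : ℕ) = ∑ a : Fin q, ∑ j : Fin δ,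
      Finset.card {b : Fin q | ((a + q * j + b : ℕ) : ZMod δ) = 0} * j := by
  rw [← Finset.sum_subtype (Finset.univ.filter
    fun t : (Fin q × Fin q) × Fin δ => ((t.1.1 + t.1.2 + q * t.2 : ℕ) : ZMod δ) = 0)
    (by simp) (fun t => (t.2 : ℕ)), Finset.sum_filter, Fintype.sum_prod_type,
    Fintype.sum_prod_type]
  refine Finset.sum_congr rfl fun a _ => ?_
  rw [Finset.sum_comm]
  refine Finset.sum_congr rfl fun j _ => ?_
  rw [Finset.card_filter, Finset.sum_mul]
  refine Finset.sum_congr rfl fun b _ => ?_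
  simp only [add_right_comm, ite_mul, one_mul, zero_mul]

theorem abs_sum_frobeniusIndex_sub_le {δ : ℕ} (hδ : 0 < δ) (q : ℕ) :
    |((∑ t : FrobeniusIndex δ q, (t.1.2 : ℕ) : ℕ) : ℝ) - q ^ 2 * (((δ : ℝ) - 1) / 2)| ≤
      q * (δ * (((δ : ℝ) - 1) / 2)) := by
  have hδ' : (δ : ℝ) ≠ 0 := Nat.cast_ne_zero.2 hδ.ne'
  have hsum : ∑ j : Fin δ, (j : ℝ) = δ * (((δ : ℝ) - 1) / 2) := by
    rw [Fin.sum_univ_eq_sum_range (fun j => (j : ℝ)), ← Nat.cast_sum]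
    have h := congrArg (Nat.cast (R := ℝ)) (Finset.sum_range_id_mul_two δ)
    rw [Nat.cast_mul, Nat.cast_mul, Nat.cast_pred hδ] at h
    push_cast at h ⊢
    linarith
  have hmain : (q : ℝ) ^ 2 * (((δ : ℝ) - 1) / 2) =
      ∑ _a : Fin q, ∑ j : Fin δ, (q : ℝ) / δ * j := by
    rw [← Finset.mul_sum, hsum, Finset.sum_const, Finset.card_univ, Fintype.card_fin,
      nsmul_eq_mul]
    field_simp
  have herr : (q : ℝ) * (δ * (((δ : ℝ) - 1) / 2)) = ∑ _a : Fin q, ∑ j : Fin δ, (j : ℝ) := by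
    rw [hsum, Finset.sum_const, Finset.card_univ, Fintype.card_fin, nsmul_eq_mul]
  rw [sum_frobeniusIndex, hmain, herr]
  push_cast
  rw [← Finset.sum_sub_distrib]
  refine (Finset.abs_sum_le_sum_abs _ _).trans (Finset.sum_le_sum fun a _ => ?_)
  rw [← Finset.sum_sub_distrib]
  refine (Finset.abs_sum_le_sum_abs _ _).trans (Finset.sum_le_sum fun j _ => ?_)
  rw [← sub_mul, abs_mul, Nat.abs_cast]
  have h := abs_card_sub_div_le_one hδ q (a + q * j)
  push_cast at h
  exact mul_le_of_le_one_left (Nat.cast_nonneg _) h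

theorem tendsto_sum_frobeniusIndex_div {δ : ℕ} (hδ : 0 < δ) :
    Tendsto (fun q : ℕ => ((∑ t : FrobeniusIndex δ q, (t.1.2 : ℕ) : ℕ) : ℝ) / (q : ℝ) ^ 2) atTop
      (nhds (((δ : ℝ) - 1) / 2)) := by
  rw [tendsto_iff_norm_sub_tendsto_zero]
  refine squeeze_zero' (Eventually.of_forall fun _ => norm_nonneg _) ?_
    (tendsto_const_div_atTop_nhds_zero_nat (δ * (((δ : ℝ) - 1) / 2)))
  filter_upwards [eventually_gt_atTop 0] with q hq
  have hq' : (0 : ℝ) < q := Nat.cast_pos.2 hq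
  have h := abs_sum_frobeniusIndex_sub_le hδ q
  rw [Real.norm_eq_abs, div_sub' (pow_pos hq' 2).ne', abs_div, abs_of_pos (pow_pos hq' 2),
    div_le_div_iff₀ (pow_pos hq' 2) hq']
  calc _ ≤ q * (δ * (((δ : ℝ) - 1) / 2)) * q := mul_le_mul_of_nonneg_right h hq'.le
    _ = _ := by ring

end Veronese

theorem frobeniusBetti_veronese (p : ℕ) [Fact p.Prime] (k : Type) [Field k] [IsAlgClosed k]
    [CharP k p] (δ : ℕ) (hδ : 2 ≤ δ) (i : ℕ) (hi : 1 ≤ i) :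
    Tendsto (fun e : ℕ => (betti k δ i ↥(eR k δ p e) : ℝ) / (p : ℝ) ^ (2 * e)) atTop
      (nhds (δ * (δ - 1) ^ i / 2)) := by
  have hδ0 : 0 < δ := by omega
  obtain ⟨n, rfl⟩ := Nat.exists_eq_add_of_le' hi
  have h := ((tendsto_sum_frobeniusIndex_div hδ0).comp
    (tendsto_pow_atTop_atTop_of_one_lt (Fact.out : p.Prime).one_lt)).mul_const
    ((δ : ℝ) * ((δ : ℝ) - 1) ^ n)
  convert h using 1
  · funext e
    rw [betti_eR k p e hδ0 n]
    simp only [Function.comp_apply]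
    push_cast [Nat.cast_sub hδ0]
    ring
  · congr 1
    ring
end
end

section
/- Let k be an algebraically closed field of prime characteristic p, δ ≥ 2, q = p^e > δ, and fix 0 ≤ l ≤ δ−1 and (i,j) ∈ ℤ² with lq ≤ i < (l+1)q, 0 ≤ j < q, and δ dividing i+j. Then the R-submodule of ^eS generated by the l+1 monomials x^(i−mq) y^(j+mq) for 0 ≤ m ≤ l is isomorphic to M^(l) as an R-module. -/
open MvPolynomial CategoryTheory Filter

set_option synthInstance.maxHeartbeats 1000000
set_option maxHeartbeats 2000000

noncomputable section

variable (k : Type) [Field k]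

/-- `^eS` : `S` viewed as an `R`-module via the `e`-th iterate of the Frobenius of `S`. -/
def eS (δ : ℕ) (p : ℕ) [Fact p.Prime] [CharP k p] (e : ℕ) : ModuleCat ↥(Rver k δ) :=
  (ModuleCat.restrictScalars
    ((iterateFrobenius (MvPolynomial (Fin 2) k) p e).comp (Rver k δ).val.toRingHom)).obj
    (ModuleCat.of (MvPolynomial (Fin 2) k) (MvPolynomial (Fin 2) k))

/-- A polynomial in `S`, regarded as an element of `^eS`. -/
def toES (δ : ℕ) (p : ℕ) [Fact p.Prime] [CharP k p] (e : ℕ) (g : MvPolynomial (Fin 2) k) :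
    ↥(eS k δ p e) := g

/-- The `R`-linear map `S → ^eS` sending `g` to `c * g ^ (p ^ e)`. -/
def frobeniusMul (δ : ℕ) (p : ℕ) [Fact p.Prime] [CharP k p] (e : ℕ)
    (c : MvPolynomial (Fin 2) k) : MvPolynomial (Fin 2) k →ₗ[↥(Rver k δ)] ↥(eS k δ p e) where
  toFun g := toES k δ p e (c * iterateFrobenius (MvPolynomial (Fin 2) k) p e g)
  map_add' g h := by
    rw [map_add, mul_add]
    rfl
  map_smul' r g := by
    change c * iterateFrobenius (MvPolynomial (Fin 2) k) p e (r.1 * g) =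
      iterateFrobenius (MvPolynomial (Fin 2) k) p e r.1 *
        (c * iterateFrobenius (MvPolynomial (Fin 2) k) p e g)
    rw [map_mul, mul_left_comm]

theorem frobeniusMul_apply (δ : ℕ) (p : ℕ) [Fact p.Prime] [CharP k p] (e : ℕ)
    (c g : MvPolynomial (Fin 2) k) :
    frobeniusMul k δ p e c g = toES k δ p e (c * g ^ p ^ e) := rfl

theorem frobeniusMul_injective (δ : ℕ) (p : ℕ) [Fact p.Prime] [CharP k p] (e : ℕ)
    {c : MvPolynomial (Fin 2) k} (hc : c ≠ 0) :
    Function.Injective (frobeniusMul k δ p e c) := fun _ _ h =>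
  iterateFrobenius_inj (MvPolynomial (Fin 2) k) p e (mul_left_cancel₀ hc h)

theorem frobeniusMul_monomial (δ : ℕ) (p : ℕ) [Fact p.Prime] [CharP k p] (e : ℕ)
    {l i m : ℕ} (j : ℕ) (hi : l * p ^ e ≤ i) (hm : m ≤ l) :
    frobeniusMul k δ p e (X 0 ^ (i - l * p ^ e) * X 1 ^ j) (X 0 ^ (l - m) * X 1 ^ m) =
      toES k δ p e (X 0 ^ (i - m * p ^ e) * X 1 ^ (j + m * p ^ e)) := by
  have hexp : i - m * p ^ e = (i - l * p ^ e) + (l - m) * p ^ e := by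
    have := Nat.mul_le_mul_right (p ^ e) hm
    rw [Nat.sub_mul]
    omega
  rw [frobeniusMul_apply, hexp, mul_pow, ← pow_mul, ← pow_mul, pow_add, pow_add,
    mul_mul_mul_comm]

theorem span_monomials_iso_Mmod (p : ℕ) [Fact p.Prime] (k : Type) [Field k] [IsAlgClosed k]
    [CharP k p] (δ : ℕ) (hδ : 2 ≤ δ) (e : ℕ) (hq : δ < p ^ e) (l : ℕ) (hl : l ≤ δ - 1)
    (i j : ℕ) (hi1 : l * p ^ e ≤ i) (hi2 : i < (l + 1) * p ^ e) (hj : j < p ^ e)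
    (hdvd : δ ∣ i + j) :
    Nonempty
      (↥(Submodule.span ↥(Rver k δ)
          { g : ↥(eS k δ p e) |
            ∃ m ≤ l, g = toES k δ p e (X 0 ^ (i - m * p ^ e) * X 1 ^ (j + m * p ^ e)) })
        ≃ₗ[↥(Rver k δ)] ↥(Mmod k δ l)) := by
  have hc : (X 0 ^ (i - l * p ^ e) * X 1 ^ j : MvPolynomial (Fin 2) k) ≠ 0 :=
    mul_ne_zero (pow_ne_zero _ (X_ne_zero _)) (pow_ne_zero _ (X_ne_zero _))
  have hmap : (Mmod k δ l).map (frobeniusMul k δ p e (X 0 ^ (i - l * p ^ e) * X 1 ^ j)) =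
      Submodule.span ↥(Rver k δ)
        { g : ↥(eS k δ p e) |
          ∃ m ≤ l, g = toES k δ p e (X 0 ^ (i - m * p ^ e) * X 1 ^ (j + m * p ^ e)) } := by
    rw [Mmod, Submodule.map_span]
    congr 1
    ext g
    constructor
    · rintro ⟨_, ⟨m, hm, rfl⟩, rfl⟩
      exact ⟨m, hm, frobeniusMul_monomial k δ p e j hi1 hm⟩
    · rintro ⟨m, hm, rfl⟩
      exact ⟨_, ⟨m, hm, rfl⟩, frobeniusMul_monomial k δ p e j hi1 hm⟩
  rw [← hmap]
  exact ⟨(Submodule.equivMapOfInjective _ (frobeniusMul_injective k δ p e hc) _).symm⟩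
end
end

section
/- Let k be an algebraically closed field of prime characteristic p. For e ≥ 1 let a_e be the largest integer n such that the free module R^n is a direct summand of the R-module ^eR. Then the F-signature of R equals 5/12; that is, a_e / p^(3e) converges to 5/12 as e → ∞. -/
open MvPolynomial CategoryTheory Filter

set_option synthInstance.maxHeartbeats 1000000
set_option maxHeartbeats 2000000

noncomputable section

variable (k : Type) [Field k]

/-- The generating monomials `x², xy, y², xz, yz` of the scroll of type `(2,1)`. -/
def sgen : Set (MvPolynomial (Fin 3) k) :=
  {X 0 ^ 2, X 0 * X 1, X 1 ^ 2, X 0 * X 2, X 1 * X 2}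

/-- `R = k[x², xy, y², xz, yz]`, the homogeneous coordinate ring of the scroll of
type `(2,1)`. -/
def Rscr : Subalgebra k (MvPolynomial (Fin 3) k) := Algebra.adjoin k (sgen k)

/-- The `e`-th iterated Frobenius endomorphism `r ↦ r^(p^e)` of `R`. -/
def frobRscr (p : ℕ) [Fact p.Prime] [CharP k p] (e : ℕ) : ↥(Rscr k) →+* ↥(Rscr k) :=
  letI : CharP ↥(Rscr k) p :=
    CharP.subsemiring (MvPolynomial (Fin 3) k) p (Rscr k).toSubsemiring
  iterateFrobenius ↥(Rscr k) p e

/-- `^eR` : `R` viewed as an `R`-module by restriction of scalars along the `e`-th iterate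
of the Frobenius endomorphism. -/
def eRscr (p : ℕ) [Fact p.Prime] [CharP k p] (e : ℕ) : ModuleCat ↥(Rscr k) :=
  (ModuleCat.restrictScalars (frobRscr k p e)).obj (ModuleCat.of ↥(Rscr k) ↥(Rscr k))


/-- The exponents of the monomials lying in `R`. -/
def InCone (s : Fin 3 →₀ ℕ) : Prop := s 2 ≤ s 0 + s 1 ∧ Even (s 0 + s 1 + s 2)

lemma X_pow_mul_mem (c : ℕ) : ∀ a b : ℕ, c ≤ a + b → Even (a + b + c) →
    (X 0 ^ a * X 1 ^ b * X 2 ^ c : MvPolynomial (Fin 3) k) ∈ Rscr k := by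
  have hgen : ∀ f ∈ sgen k, f ∈ Rscr k := fun f hf => Algebra.subset_adjoin hf
  have hxx : (X 0 ^ 2 : MvPolynomial (Fin 3) k) ∈ Rscr k := hgen _ (by simp [sgen])
  have hxy : (X 0 * X 1 : MvPolynomial (Fin 3) k) ∈ Rscr k := hgen _ (by simp [sgen])
  have hyy : (X 1 ^ 2 : MvPolynomial (Fin 3) k) ∈ Rscr k := hgen _ (by simp [sgen])
  have hxz : (X 0 * X 2 : MvPolynomial (Fin 3) k) ∈ Rscr k := hgen _ (by simp [sgen])
  have hyz : (X 1 * X 2 : MvPolynomial (Fin 3) k) ∈ Rscr k := hgen _ (by simp [sgen])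
  induction c with
  | zero =>
    intro a b _ he
    have he' : Even (a + b) := by simpa using he
    rcases Nat.even_or_odd' a with ⟨i, rfl | rfl⟩ <;> rcases Nat.even_or_odd' b with ⟨j, rfl | rfl⟩
    · convert (Rscr k).mul_mem ((Rscr k).pow_mem hxx i) ((Rscr k).pow_mem hyy j) using 1
      ring
    · exact absurd he' (by grind)
    · exact absurd he' (by grind)
    · convert (Rscr k).mul_mem hxy
        ((Rscr k).mul_mem ((Rscr k).pow_mem hxx i) ((Rscr k).pow_mem hyy j)) using 1
      ring
  | succ c ih =>
    intro a b h he
    rcases a with _ | a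
    · rcases b with _ | b
      · omega
      · convert (Rscr k).mul_mem hyz (ih 0 b (by omega) (by grind)) using 1
        ring
    · convert (Rscr k).mul_mem hxz (ih a b (by omega) (by grind)) using 1
      ring

variable {k}

lemma monomial_mem_Rscr {s : Fin 3 →₀ ℕ} (hs : InCone s) (c : k) :
    monomial s c ∈ Rscr k := by
  have h := (Rscr k).smul_mem (X_pow_mul_mem k (s 2) (s 0) (s 1) hs.1 hs.2) c
  convert h using 1
  rw [monomial_eq, Finsupp.prod_fintype _ _ (by simp), Fin.prod_univ_three, smul_eq_C_mul]

lemma inCone_of_mem_support {f : MvPolynomial (Fin 3) k} (hf : f ∈ Rscr k) :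
    ∀ s, coeff s f ≠ 0 → InCone s := by
  refine Algebra.adjoin_induction (p := fun f _ => ∀ s, coeff s f ≠ 0 → InCone s)
    ?_ ?_ ?_ ?_ hf
  · have key : ∀ (a b c : ℕ), c ≤ a + b → Even (a + b + c) → ∀ s : Fin 3 →₀ ℕ,
        coeff s (X 0 ^ a * X 1 ^ b * X 2 ^ c : MvPolynomial (Fin 3) k) ≠ 0 → InCone s := by
      intro a b c h he s hs
      simp only [X_pow_eq_monomial, monomial_mul, coeff_monomial, mul_one, ne_eq,
        ite_eq_right_iff, one_ne_zero, imp_false, not_not] at hs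
      subst hs
      exact ⟨by simpa using h, by simpa using he⟩
    rintro x (rfl | rfl | rfl | rfl | rfl)
    · simpa using key 2 0 0 (by omega) (by decide)
    · simpa using key 1 1 0 (by omega) (by decide)
    · simpa using key 0 2 0 (by omega) (by decide)
    · simpa using key 1 0 1 (by omega) (by decide)
    · simpa using key 0 1 1 (by omega) (by decide)
  · intro r s hs
    rw [algebraMap_eq, coeff_C] at hs
    obtain rfl : 0 = s := by by_contra h; simp [h] at hs
    exact ⟨by simp, by simp⟩
  · intro x y _ _ hx hy s hs
    by_cases h : coeff s x = 0
    · exact hy s (by simpa [h] using hs)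
    · exact hx s h
  · intro x y _ _ hx hy s hs
    rw [coeff_mul] at hs
    obtain ⟨⟨i, j⟩, hij, hne⟩ := Finset.exists_ne_zero_of_sum_ne_zero hs
    obtain rfl := Finset.HasAntidiagonal.mem_antidiagonal.1 hij
    obtain ⟨h1, h2⟩ := hx i (left_ne_zero_of_mul hne)
    obtain ⟨h3, h4⟩ := hy j (right_ne_zero_of_mul hne)
    refine ⟨by simp only [Finsupp.add_apply]; omega, ?_⟩
    simp only [Finsupp.add_apply]
    grind

lemma mem_Rscr_iff {f : MvPolynomial (Fin 3) k} :
    f ∈ Rscr k ↔ ∀ s, coeff s f ≠ 0 → InCone s := by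
  refine ⟨inCone_of_mem_support, fun h => ?_⟩
  rw [f.as_sum]
  exact sum_mem fun s hs => monomial_mem_Rscr (h s (mem_support_iff.1 hs)) _

variable (k) in
/-- The monomial with exponent `s`, as an element of `R`. -/
def mon (s : Fin 3 →₀ ℕ) (hs : InCone s) (c : k) : ↥(Rscr k) :=
  ⟨monomial s c, monomial_mem_Rscr hs c⟩

/-- Exponents of the monomials which generate the free summands of `R` over `R^q`. -/
def freeExps (q : ℕ) : Finset (ℕ × ℕ × ℕ) :=
  (Finset.range q ×ˢ Finset.range q ×ˢ Finset.range q).filter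
    fun t => t.2.2 ≤ t.1 + t.2.1 ∧ Even (t.1 + t.2.1 + t.2.2)

/-- A triple of exponents as a multidegree. -/
def toExp (t : ℕ × ℕ × ℕ) : Fin 3 →₀ ℕ := Finsupp.equivFunOnFinite.symm ![t.1, t.2.1, t.2.2]

@[simp] lemma toExp_zero (t : ℕ × ℕ × ℕ) : toExp t 0 = t.1 := rfl
@[simp] lemma toExp_one (t : ℕ × ℕ × ℕ) : toExp t 1 = t.2.1 := rfl
@[simp] lemma toExp_two (t : ℕ × ℕ × ℕ) : toExp t 2 = t.2.2 := rfl

lemma toExp_injective : Function.Injective toExp := by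
  intro s t h
  have h0 := DFunLike.congr_fun h 0
  have h1 := DFunLike.congr_fun h 1
  have h2 := DFunLike.congr_fun h 2
  simp only [toExp_zero, toExp_one, toExp_two] at h0 h1 h2
  ext <;> assumption

lemma toExp_surjective : Function.Surjective toExp := fun s =>
  ⟨(s 0, s 1, s 2), by ext i; fin_cases i <;> rfl⟩

lemma mem_freeExps {q : ℕ} {t : ℕ × ℕ × ℕ} :
    t ∈ freeExps q ↔ (t.1 < q ∧ t.2.1 < q ∧ t.2.2 < q) ∧ InCone (toExp t) := by
  simp [freeExps, InCone]

lemma coe_frobRscr (p : ℕ) [Fact p.Prime] [CharP k p] (e : ℕ) (r : ↥(Rscr k)) :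
    (frobRscr k p e r : MvPolynomial (Fin 3) k) = (r : MvPolynomial (Fin 3) k) ^ p ^ e := rfl

lemma frobRscr_mon (p : ℕ) [Fact p.Prime] [CharP k p] (e : ℕ) (s : Fin 3 →₀ ℕ)
    (hs : InCone s) (c : k) :
    (frobRscr k p e (mon k s hs c) : MvPolynomial (Fin 3) k)
      = monomial (p ^ e • s) (c ^ p ^ e) := by
  rw [coe_frobRscr, mon, monomial_pow]

section UpperBound

variable {p : ℕ} [Fact p.Prime] [CharP k p] {e : ℕ}

lemma constantCoeff_eq_zero_of_relation (φ : ↥(Rscr k) → ↥(Rscr k))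
    (hφ : ∀ r f, φ (frobRscr k p e r * f) = r * φ f)
    {s t u v : Fin 3 →₀ ℕ} (hs : InCone s) (ht : InCone t) (hu : InCone u) (hv : InCone v)
    (h : p ^ e • s + u = p ^ e • t + v) (hts : ¬ t ≤ s) :
    constantCoeff (φ (mon k u hu 1) : MvPolynomial (Fin 3) k) = 0 := by
  have key : frobRscr k p e (mon k s hs 1) * mon k u hu 1
      = frobRscr k p e (mon k t ht 1) * mon k v hv 1 := by
    apply Subtype.ext
    rw [MulMemClass.coe_mul, MulMemClass.coe_mul, frobRscr_mon, frobRscr_mon]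
    simp [mon, monomial_mul, h]
  have key2 := congrArg φ key
  rw [hφ, hφ] at key2
  have key3 := congrArg (fun r : ↥(Rscr k) => coeff s (r : MvPolynomial (Fin 3) k)) key2
  simpa [mon, coeff_monomial_mul', hts, constantCoeff_eq] using key3

lemma constantCoeff_eq_zero_of_not_lt (φ : ↥(Rscr k) → ↥(Rscr k))
    (hφ : ∀ r f, φ (frobRscr k p e r * f) = r * φ f) {u : ℕ × ℕ × ℕ} (hu : InCone (toExp u))
    (hq : ¬ (u.1 < p ^ e ∧ u.2.1 < p ^ e ∧ u.2.2 < p ^ e)) :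
    constantCoeff (φ (mon k (toExp u) hu 1) : MvPolynomial (Fin 3) k) = 0 := by
  obtain ⟨a, b, c⟩ := u
  obtain ⟨h1, h2⟩ := id hu
  simp only [toExp_zero, toExp_one, toExp_two] at h1 h2 hq
  have hrel : ∀ s t v : ℕ × ℕ × ℕ, InCone (toExp s) → InCone (toExp t) →
      p ^ e * s.1 + a = p ^ e * t.1 + v.1 → p ^ e * s.2.1 + b = p ^ e * t.2.1 + v.2.1 →
      p ^ e * s.2.2 + c = p ^ e * t.2.2 + v.2.2 → v.2.2 ≤ v.1 + v.2.1 →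
      Even (v.1 + v.2.1 + v.2.2) → (¬ toExp t ≤ toExp s) →
      constantCoeff (φ (mon k (toExp (a, b, c)) hu 1) : MvPolynomial (Fin 3) k) = 0 := by
    intro s t v hs ht e0 e1 e2 hv hv' hts
    refine constantCoeff_eq_zero_of_relation φ hφ hs ht hu (v := toExp v) ⟨hv, hv'⟩ ?_ hts
    ext i
    fin_cases i
    · simpa using e0
    · simpa using e1
    · simpa using e2
  by_cases ha : a < p ^ e
  · by_cases hb : b < p ^ e
    · have hc : p ^ e ≤ c := by simpa [ha, hb] using hq
      obtain ⟨c, rfl⟩ := Nat.exists_eq_add_of_le hc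
      exact hrel (2, 0, 0) (1, 0, 1) (a + p ^ e, b, c) ⟨by simp, by decide⟩ ⟨by simp, by decide⟩
        (by ring) (by ring) (by ring) (by simp only; omega) (by simp only; grind)
        (fun h => by simpa using h 2)
    · obtain ⟨b, rfl⟩ := Nat.exists_eq_add_of_le (not_lt.1 hb)
      exact hrel (1, 1, 0) (0, 2, 0) (a + p ^ e, b, c) ⟨by simp, by decide⟩ ⟨by simp, by decide⟩
        (by ring) (by ring) (by ring) (by simp only; omega) (by simp only; grind)
        (fun h => by simpa using h 1)
  · obtain ⟨a, rfl⟩ := Nat.exists_eq_add_of_le (not_lt.1 ha)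
    exact hrel (1, 1, 0) (2, 0, 0) (a, b + p ^ e, c) ⟨by simp, by decide⟩ ⟨by simp, by decide⟩
      (by ring) (by ring) (by ring) (by simp only; omega) (by simp only; grind)
      (fun h => by simpa using h 0)

lemma le_card_freeExps [PerfectRing k p] {n : ℕ} (φ : ↥(Rscr k) →+ (Fin n → ↥(Rscr k)))
    (hφ : ∀ r f, φ (frobRscr k p e r * f) = r • φ f) (hsurj : Function.Surjective φ) :
    n ≤ (freeExps (p ^ e)).card := by
  classical
  let π : Fin n → ↥(Rscr k) →+ k := fun i =>
    (((constantCoeff : MvPolynomial (Fin 3) k →+* k).comp (Rscr k).val.toRingHom).toAddMonoidHom).comp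
      ((Pi.evalAddMonoidHom _ i).comp φ)
  let A : Matrix (Fin n) ↥(freeExps (p ^ e)) k :=
    fun i u => π i (mon k (toExp u) (mem_freeExps.1 u.2).2 1)
  have hπ : ∀ (i : Fin n) (u : Fin 3 →₀ ℕ) (hu : InCone u) (c : k),
      π i (mon k u hu (c ^ p ^ e)) = c * π i (mon k u hu 1) := by
    intro i u hu c
    have h0 : InCone 0 := ⟨by simp, by simp⟩
    have : mon k u hu (c ^ p ^ e) = frobRscr k p e (mon k 0 h0 c) * mon k u hu 1 := by
      apply Subtype.ext
      rw [MulMemClass.coe_mul, frobRscr_mon]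
      simp only [mon, monomial_mul, smul_zero, zero_add, mul_one]
    rw [this]
    simp [π, hφ, mon]
  have hA : Function.Surjective A.mulVecLin := by
    intro w
    obtain ⟨f, hf⟩ := hsurj (fun i => algebraMap k _ (w i))
    let σ := (iterateFrobeniusEquiv k p e).symm
    have hσ : ∀ c, σ c ^ p ^ e = c := fun c => (iterateFrobeniusEquiv k p e).apply_symm_apply c
    refine ⟨fun u => σ (coeff (toExp u) (f : MvPolynomial (Fin 3) k)), ?_⟩
    ext i
    have hw : w i = π i f := by simp [π, hf]
    have hsum : f = ∑ s ∈ (f : MvPolynomial (Fin 3) k).support.attach,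
        mon k s (inCone_of_mem_support f.2 s (mem_support_iff.1 s.2))
          (coeff s (f : MvPolynomial (Fin 3) k)) := by
      apply Subtype.ext
      rw [AddSubmonoidClass.coe_finsetSum]
      simp only [mon]
      rw [Finset.sum_attach _ fun s => monomial s (coeff s (f : MvPolynomial (Fin 3) k))]
      exact as_sum _
    let F : (Fin 3 →₀ ℕ) → k := fun s => if hs : InCone s then
      σ (coeff s (f : MvPolynomial (Fin 3) k)) * π i (mon k s hs 1) else 0
    have hF : π i f = ∑ s ∈ (f : MvPolynomial (Fin 3) k).support, F s := by
      conv_lhs => rw [hsum]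
      rw [map_sum, ← Finset.sum_attach _ F]
      refine Finset.sum_congr rfl fun s _ => ?_
      have hs := inCone_of_mem_support f.2 s (mem_support_iff.1 s.2)
      simp only [F, dif_pos hs]
      rw [← hπ, hσ]
    have hG : (A.mulVecLin fun u => σ (coeff (toExp u) (f : MvPolynomial (Fin 3) k))) i
        = ∑ s ∈ (freeExps (p ^ e)).image toExp, F s := by
      rw [Finset.sum_image toExp_injective.injOn, ← Finset.sum_coe_sort]
      simp only [Matrix.mulVecLin_apply, Matrix.mulVec, dotProduct]
      refine Finset.sum_congr rfl fun u _ => ?_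
      simp only [F, A, dif_pos (mem_freeExps.1 u.2).2, mul_comm]
    rw [hG, hw, hF]
    refine Finset.sum_congr_of_eq_on_inter ?_ ?_ fun _ _ _ => rfl
    · intro s _ hs
      by_contra hne
      have : coeff s (f : MvPolynomial (Fin 3) k) = 0 := notMem_support_iff.1 hs
      simp [F, this] at hne
    · refine toExp_surjective.forall.2 fun u _ hs => ?_
      by_cases hc : InCone (toExp u)
      · simp only [F, dif_pos hc]
        have hz : π i (mon k _ hc 1) = 0 :=
          constantCoeff_eq_zero_of_not_lt (fun f => φ f i) (fun r f => by simp [hφ]) hc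
            (fun h => hs (Finset.mem_image_of_mem _ (mem_freeExps.2 ⟨h, hc⟩)))
        rw [hz, mul_zero]
      · simp [F, hc]
  simpa using LinearMap.finrank_le_finrank_of_surjective hA

end UpperBound

section LowerBound

universe w

variable {p : ℕ} [Fact p.Prime] [CharP k p] [PerfectRing k p] {e : ℕ}

lemma add_pow_smul_injective (p : ℕ) [Fact p.Prime] (e : ℕ) (u : Fin 3 →₀ ℕ) :
    Function.Injective fun s : Fin 3 →₀ ℕ => u + p ^ e • s := by
  intro s t h
  have hp : p ≠ 0 := (Fact.out : p.Prime).ne_zero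
  ext i
  have := DFunLike.congr_fun h i
  simpa [hp] using this

open Classical in
variable (k p e) in
/-- The projection of `k[x,y,z]` to itself which sends `x^(u + p^e s)` to `x^s` for `s` of even
degree, sends the other monomials to zero, and is inverse Frobenius semilinear over `k`. -/
def frobProj (u : Fin 3 →₀ ℕ) (f : MvPolynomial (Fin 3) k) : MvPolynomial (Fin 3) k :=
  ∑ s ∈ f.support.preimage (fun s => u + p ^ e • s) (add_pow_smul_injective p e u).injOn,
    monomial s (if Even (s 0 + s 1 + s 2) then
      (iterateFrobeniusEquiv k p e).symm (coeff (u + p ^ e • s) f) else 0)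

open Classical in
lemma coeff_frobProj (u : Fin 3 →₀ ℕ) (f : MvPolynomial (Fin 3) k) (s : Fin 3 →₀ ℕ) :
    coeff s (frobProj k p e u f) = if Even (s 0 + s 1 + s 2) then
      (iterateFrobeniusEquiv k p e).symm (coeff (u + p ^ e • s) f) else 0 := by
  simp only [frobProj, coeff_sum, coeff_monomial, Finset.sum_ite_eq', Finset.mem_preimage]
  split_ifs with h1 h2 h2
  · rfl
  · rfl
  · rw [notMem_support_iff.1 h1, map_zero]
  · rfl

lemma frobProj_add (u : Fin 3 →₀ ℕ) (f g : MvPolynomial (Fin 3) k) :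
    frobProj k p e u (f + g) = frobProj k p e u f + frobProj k p e u g := by
  ext s
  simp only [coeff_frobProj, coeff_add]
  split_ifs <;> simp

lemma frobProj_monomial_mul {u : Fin 3 →₀ ℕ} (hu : ∀ i, u i < p ^ e) {t : Fin 3 →₀ ℕ}
    (ht : Even (t 0 + t 1 + t 2)) (c : k) (f : MvPolynomial (Fin 3) k) :
    frobProj k p e u (monomial t c ^ p ^ e * f) = monomial t c * frobProj k p e u f := by
  ext s
  have hle : p ^ e • t ≤ u + p ^ e • s ↔ t ≤ s := by
    refine forall_congr' fun i => ?_
    have := hu i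
    simp only [Finsupp.smul_apply, Finsupp.add_apply, smul_eq_mul]
    constructor
    · intro h
      by_contra! h'
      nlinarith
    · intro h
      nlinarith [Nat.zero_le (u i), Nat.mul_le_mul_left (p ^ e) h]
  by_cases hts : t ≤ s
  · obtain ⟨s, rfl⟩ := exists_add_of_le hts
    have hpar : Even ((t + s) 0 + (t + s) 1 + (t + s) 2) ↔ Even (s 0 + s 1 + s 2) := by
      simp only [Finsupp.add_apply]
      grind
    have hexp : u + p ^ e • (t + s) = p ^ e • t + (u + p ^ e • s) := by
      rw [smul_add]; abel
    have hc : (iterateFrobeniusEquiv k p e).symm (c ^ p ^ e) = c :=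
      (iterateFrobeniusEquiv k p e).symm_apply_apply c
    rw [coeff_frobProj, coeff_monomial_mul, coeff_frobProj, monomial_pow, hexp,
      coeff_monomial_mul, map_mul, hc, if_congr hpar rfl rfl, mul_ite, mul_zero]
  · simp [coeff_frobProj, coeff_monomial_mul', monomial_pow, hts, hle]

lemma frobProj_frobRscr_mul {u : Fin 3 →₀ ℕ} (hu : ∀ i, u i < p ^ e) (r : ↥(Rscr k))
    (f : MvPolynomial (Fin 3) k) :
    frobProj k p e u ((frobRscr k p e r : MvPolynomial (Fin 3) k) * f)
      = r * frobProj k p e u f := by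
  let P : MvPolynomial (Fin 3) k →+ MvPolynomial (Fin 3) k :=
    AddMonoidHom.mk' (frobProj k p e u) (frobProj_add u)
  have hP : ∀ g, frobProj k p e u g = P g := fun _ => rfl
  rw [coe_frobRscr]
  conv_lhs => rw [(r : MvPolynomial (Fin 3) k).as_sum]
  conv_rhs => rw [(r : MvPolynomial (Fin 3) k).as_sum]
  rw [sum_pow_char_pow, Finset.sum_mul, Finset.sum_mul, hP, map_sum]
  refine Finset.sum_congr rfl fun t ht => ?_
  exact frobProj_monomial_mul hu (inCone_of_mem_support r.2 t (mem_support_iff.1 ht)).2 _ _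

lemma frobProj_mem {u : Fin 3 →₀ ℕ} (hu : ∀ i, u i < p ^ e) {f : MvPolynomial (Fin 3) k}
    (hf : f ∈ Rscr k) : frobProj k p e u f ∈ Rscr k := by
  refine mem_Rscr_iff.2 fun s hs => ?_
  rw [coeff_frobProj] at hs
  split_ifs at hs with hpar
  · refine ⟨?_, hpar⟩
    have hne : coeff (u + p ^ e • s) f ≠ 0 := fun h => hs (by rw [h, map_zero])
    have h := (inCone_of_mem_support hf _ hne).1
    simp only [Finsupp.smul_apply, Finsupp.add_apply, smul_eq_mul] at h
    have h0 := hu 0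
    have h1 := hu 1
    by_contra! hlt
    have hlt2 : s 0 + s 1 + 2 ≤ s 2 := by grind
    nlinarith [Nat.mul_le_mul_left (p ^ e) hlt2]
  · exact absurd rfl hs

lemma frobProj_monomial {u v : Fin 3 →₀ ℕ} (hv : ∀ i, v i < p ^ e) :
    frobProj k p e u (monomial v 1) = if u = v then 1 else 0 := by
  ext s
  have key : v = u + p ^ e • s ↔ u = v ∧ 0 = s := by
    constructor
    · intro h
      obtain rfl : 0 = s := by
        ext i
        have h1 := DFunLike.congr_fun h i
        have h2 := hv i
        simp only [Finsupp.smul_apply, Finsupp.add_apply, smul_eq_mul] at h1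
        by_contra h3
        have : 1 ≤ s i := Nat.one_le_iff_ne_zero.2 (Ne.symm h3)
        nlinarith
      simpa using h.symm
    · rintro ⟨rfl, rfl⟩
      simp
  rw [coeff_frobProj, coeff_monomial, if_congr key rfl rfl]
  by_cases h : u = v <;> by_cases hs : 0 = s
  · subst hs; simp [h]
  · simp [h, hs, coeff_one]
  · simp [h]
  · simp [h]

variable (k p e) in
/-- The coordinates of `^eR → R^n` given by the projections `frobProj`. -/
def frobProjPi : ↥(eRscr k p e) →ₗ[↥(Rscr k)] (↥(freeExps (p ^ e)) → ↥(Rscr k)) where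
  toFun f u := ⟨frobProj k p e (toExp u) (show ↥(Rscr k) from f).1,
    frobProj_mem (by
      obtain ⟨h0, h1, h2⟩ := (mem_freeExps.1 u.2).1
      intro i; fin_cases i <;> assumption) (show ↥(Rscr k) from f).2⟩
  map_add' f g := by
    funext u
    exact Subtype.ext (frobProj_add _ _ _)
  map_smul' r f := by
    funext u
    exact Subtype.ext (frobProj_frobRscr_mul (by
      obtain ⟨h0, h1, h2⟩ := (mem_freeExps.1 u.2).1
      intro i; fin_cases i <;> assumption) r _)

lemma frobProjPi_surjective : Function.Surjective (frobProjPi k p e) := by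
  classical
  have hlt : ∀ u : ↥(freeExps (p ^ e)), ∀ i, toExp u i < p ^ e := by
    intro u
    obtain ⟨h0, h1, h2⟩ := (mem_freeExps.1 u.2).1
    intro i; fin_cases i <;> assumption
  let m : ↥(freeExps (p ^ e)) → ↥(eRscr k p e) :=
    fun u => (mon k (toExp u) (mem_freeExps.1 u.2).2 1 : ↥(Rscr k))
  have hm : ∀ v, frobProjPi k p e (m v) = Pi.single v 1 := by
    intro v
    funext u
    apply Subtype.ext
    refine (frobProj_monomial (hlt v)).trans ?_
    by_cases h : u = v
    · subst h; simp
    · have : ¬ toExp u = toExp v := fun h' => h (Subtype.ext (toExp_injective h'))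
      simp [h, this]
  intro r
  refine ⟨∑ v, r v • m v, ?_⟩
  simp only [map_sum, map_smul, hm]
  exact (pi_eq_sum_univ' r).symm

lemma exists_linearEquiv_prod :
    ∃ N : ModuleCat.{w} ↥(Rscr k), Nonempty (↥(eRscr k p e) ≃ₗ[↥(Rscr k)]
      ((Fin (freeExps (p ^ e)).card → ↥(Rscr k)) × ↥N)) := by
  let g := frobProjPi k p e
  obtain ⟨s, hs⟩ := Module.projective_lifting_property g LinearMap.id frobProjPi_surjective
  refine ⟨ModuleCat.of _ (ULift.{w} (LinearMap.ker g)), ⟨?_⟩⟩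
  let E := lequivProdOfRightSplitExact (j := (LinearMap.ker g).subtype) (g := g) (f := s)
    (Submodule.injective_subtype _) (Submodule.range_subtype _) hs
  exact E.symm ≪≫ₗ LinearEquiv.prodComm _ _ _ ≪≫ₗ LinearEquiv.prodCongr
    (LinearEquiv.funCongrLeft _ _ (Finset.equivFin _).symm) ULift.moduleEquiv.symm

end LowerBound

section Counting

lemma card_filter_even_add (s m : ℕ) :
    2 * ((Finset.range m).filter fun c => Even (s + c)).card ≤ m + 1 ∧
      m ≤ 2 * ((Finset.range m).filter fun c => Even (s + c)).card + 1 := by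
  induction m using Nat.twoStepInduction with
  | zero => simp
  | one =>
    have := Finset.card_filter_le (Finset.range 1) fun c => Even (s + c)
    simp only [Finset.card_range] at this
    omega
  | more m ih _ =>
    have : ((Finset.range (m + 2)).filter fun c => Even (s + c)).card
        = ((Finset.range m).filter fun c => Even (s + c)).card + 1 := by
      rw [Finset.range_add_one, Finset.range_add_one, Finset.filter_insert, Finset.filter_insert]
      by_cases h : Even (s + m)
      · rw [if_neg (by grind), if_pos h, Finset.card_insert_of_notMem (by simp)]
      · rw [if_pos (by grind), if_neg h, Finset.card_insert_of_notMem (by simp)]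
    omega

lemma sum_min_add (q : ℕ) :
    3 * (2 * ∑ a ∈ Finset.range q, ∑ b ∈ Finset.range q, ((min q (a + b + 1) : ℕ) : ℝ))
      = 5 * (q : ℝ) ^ 3 + q := by
  have hlin : ∀ (x : ℝ) (d : ℕ), 2 * ∑ b ∈ Finset.range d, (x + b + 1) = d * (2 * x + d + 1) := by
    intro x d
    induction d with
    | zero => simp
    | succ d ih =>
      rw [Finset.sum_range_succ, mul_add, ih]
      push_cast
      ring
  have inner : ∀ a ∈ Finset.range q, (2 * ∑ b ∈ Finset.range q, ((min q (a + b + 1) : ℕ) : ℝ))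
      = (q : ℝ) ^ 2 + q - a ^ 2 + 2 * a * q - a := by
    intro a ha
    obtain ⟨d, rfl⟩ := Nat.exists_eq_add_of_le (Finset.mem_range.1 ha).le
    have h1 : ∀ b ∈ Finset.range d, ((min (a + d) (a + b + 1) : ℕ) : ℝ) = (a : ℝ) + b + 1 := by
      intro b hb
      rw [min_eq_right (by have := Finset.mem_range.1 hb; omega)]
      push_cast
      ring
    have h2 : ∀ b ∈ Finset.range a, ((min (a + d) (a + (d + b) + 1) : ℕ) : ℝ) = (a : ℝ) + d := by
      intro b hb
      rw [min_eq_left (by omega)]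
      push_cast
      ring
    rw [add_comm a d, Finset.sum_range_add, add_comm d a, Finset.sum_congr rfl h1,
      Finset.sum_congr rfl h2, mul_add, hlin, Finset.sum_const, Finset.card_range]
    push_cast [nsmul_eq_mul]
    ring
  have outer : ∀ (x : ℝ) (n : ℕ),
      3 * ∑ a ∈ Finset.range n, (x ^ 2 + x - (a : ℝ) ^ 2 + 2 * a * x - a)
        = 3 * n * (x ^ 2 + x) - (n - 1) * n * (2 * n - 1) / 2
          + 3 * (2 * x - 1) * (n - 1) * n / 2 := by
    intro x n
    induction n with
    | zero => simp
    | succ n ih =>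
      rw [Finset.sum_range_succ, mul_add, ih]
      push_cast
      ring
  rw [Finset.mul_sum, Finset.sum_congr rfl inner, outer]
  ring

lemma card_freeExps_bounds (q : ℕ) :
    2 * (freeExps q).card ≤ (∑ a ∈ Finset.range q, ∑ b ∈ Finset.range q, min q (a + b + 1))
        + q ^ 2 ∧
      (∑ a ∈ Finset.range q, ∑ b ∈ Finset.range q, min q (a + b + 1))
        ≤ 2 * (freeExps q).card + q ^ 2 := by
  have hcard : (freeExps q).card = ∑ a ∈ Finset.range q, ∑ b ∈ Finset.range q,
      ((Finset.range (min q (a + b + 1))).filter fun c => Even (a + b + c)).card := by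
    rw [freeExps, Finset.card_filter, Finset.sum_product]
    refine Finset.sum_congr rfl fun a _ => ?_
    rw [Finset.sum_product]
    refine Finset.sum_congr rfl fun b _ => ?_
    rw [← Finset.card_filter]
    congr 1
    ext c
    simp only [Finset.mem_filter, Finset.mem_range, lt_min_iff, Nat.lt_succ_iff]
    tauto
  have hq : q ^ 2 = ∑ _a ∈ Finset.range q, ∑ _b ∈ Finset.range q, 1 := by simp [sq]
  rw [hcard, hq]
  simp only [Finset.mul_sum, ← Finset.sum_add_distrib]
  exact ⟨Finset.sum_le_sum fun a _ => Finset.sum_le_sum fun b _ => (card_filter_even_add _ _).1,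
    Finset.sum_le_sum fun a _ => Finset.sum_le_sum fun b _ => (card_filter_even_add _ _).2⟩

lemma abs_card_freeExps_div_sub_le {q : ℕ} (hq : 1 ≤ q) :
    |((freeExps q).card : ℝ) / (q : ℝ) ^ 3 - 5 / 12| ≤ 7 / 12 * (q : ℝ)⁻¹ := by
  obtain ⟨h1, h2⟩ := card_freeExps_bounds q
  have h3 := sum_min_add q
  have h1' : (2 * (freeExps q).card : ℝ) ≤
      (∑ a ∈ Finset.range q, ∑ b ∈ Finset.range q, ((min q (a + b + 1) : ℕ) : ℝ)) + (q : ℝ) ^ 2 := by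
    exact_mod_cast h1
  have h2' : (∑ a ∈ Finset.range q, ∑ b ∈ Finset.range q, ((min q (a + b + 1) : ℕ) : ℝ))
      ≤ (2 * (freeExps q).card : ℝ) + (q : ℝ) ^ 2 := by
    exact_mod_cast h2
  have hq' : (1 : ℝ) ≤ q := by exact_mod_cast hq
  have hq0 : (0 : ℝ) < q := by linarith
  have heq : ((freeExps q).card : ℝ) / (q : ℝ) ^ 3 - 5 / 12
      = (12 * (freeExps q).card - 5 * (q : ℝ) ^ 3) / (12 * (q : ℝ) ^ 3) := by
    field_simp
  have hrhs : 7 / 12 * (q : ℝ)⁻¹ = 7 * (q : ℝ) ^ 2 / (12 * (q : ℝ) ^ 3) := by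
    field_simp
  rw [heq, hrhs, abs_div, abs_of_pos (by positivity : (0 : ℝ) < 12 * (q : ℝ) ^ 3)]
  gcongr
  rw [abs_le]
  constructor <;> nlinarith

end Counting

lemma eq_card_freeExps_of_isGreatest.{w} {p : ℕ} [Fact p.Prime] [CharP k p] [PerfectRing k p] {e n : ℕ}
    (hn : IsGreatest {n : ℕ | ∃ N : ModuleCat.{w} ↥(Rscr k),
      Nonempty (↥(eRscr k p e) ≃ₗ[↥(Rscr k)] ((Fin n → ↥(Rscr k)) × ↥N))} n) :
    n = (freeExps (p ^ e)).card := by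
  refine le_antisymm ?_ (hn.2 exists_linearEquiv_prod)
  obtain ⟨N, ⟨E⟩⟩ := hn.1
  let φ := LinearMap.fst ↥(Rscr k) (Fin n → ↥(Rscr k)) ↥N ∘ₗ E.toLinearMap
  have hφ : Function.Surjective φ := Prod.fst_surjective.comp E.surjective
  exact le_card_freeExps (p := p) (e := e) (n := n) φ.toAddMonoidHom (fun r f => φ.map_smul r f) hφ

theorem fSignature_scroll (p : ℕ) [Fact p.Prime] (k : Type) [Field k] [IsAlgClosed k]
    [CharP k p] (a : ℕ → ℕ)
    (ha : ∀ e : ℕ, 1 ≤ e →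
      IsGreatest
        {n : ℕ | ∃ N : ModuleCat ↥(Rscr k),
          Nonempty (↥(eRscr k p e) ≃ₗ[↥(Rscr k)] ((Fin n → ↥(Rscr k)) × ↥N))}
        (a e)) :
    Tendsto (fun e : ℕ => (a e : ℝ) / (p : ℝ) ^ (3 * e)) atTop (nhds (5 / 12)) := by
  have hp : p.Prime := Fact.out
  have hlim : Tendsto (fun e : ℕ => 7 / 12 * ((p ^ e : ℕ) : ℝ)⁻¹) atTop (nhds 0) := by
    have h := (tendsto_inv_atTop_zero.comp (tendsto_natCast_atTop_atTop (R := ℝ))).comp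
      (tendsto_pow_atTop_atTop_of_one_lt hp.one_lt)
    simpa using h.const_mul (7 / 12 : ℝ)
  rw [tendsto_iff_dist_tendsto_zero]
  refine squeeze_zero' (Eventually.of_forall fun _ => dist_nonneg) ?_ hlim
  filter_upwards [eventually_ge_atTop 1] with e he
  rw [eq_card_freeExps_of_isGreatest (p := p) (k := k) (e := e) (n := a e) (ha e he), Real.dist_eq, mul_comm 3 e, pow_mul]
  simpa using abs_card_freeExps_div_sub_le (q := p ^ e) (Nat.one_le_pow _ _ hp.pos)
end
end
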